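/- arXiv:2409.03026 — 2 statements merged into one kernel-verified Lean document; each statement's English description precedes it below -/
import Mathlib

section
/- Let F be a finite family of compact convex sets in ℝ² and let M be a matroid with ground set F, rank 6, and rank function r. If every 3-element subfamily of F of rank 3 in M can be pierced by a line, then there exist 3 lines whose union intersects every member of a subfamily F' ⊆ F satisfying r(F∖F') ≤ 5. -/
/-- A line in `ℝ²`: a one-dimensional affine subspace. -/
def IsLine (l : Set (EuclideanSpace ℝ (Fin 2))) : Prop :=
  ∃ L : AffineSubspace ℝ (EuclideanSpace ℝ (Fin 2)),
    Module.finrank ℝ L.direction = 1 ∧ l = ↑L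

/-- The rank function of a matroid: `mrank M A` is the size of the largest
independent set of `M` contained in `A`. -/
noncomputable def mrank {α : Type*} (M : Matroid α) (A : Set α) : ℕ :=
  sSup {n : ℕ | ∃ I ⊆ A, M.Indep I ∧ I.ncard = n}

lemma Finset.exists_pair_of_image_eq {α β : Type*} [DecidableEq α] [DecidableEq β] {f : α → β}
    {A : Finset α} {B : Finset β} (h : A.image f = B) (hc : A.card = B.card + 1) :
    ∃ i ∈ A, ∃ j ∈ A, i ≠ j ∧ f i = f j ∧
      ∀ k ∈ A, ((A.erase k).image f = B ↔ k = i ∨ k = j) := by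
  obtain ⟨i, hi, j, hj, hij, hf⟩ := Finset.exists_ne_map_eq_of_card_lt_of_maps_to
    (s := A) (t := B) (f := f) (by omega) (fun x hx => h ▸ Finset.mem_image_of_mem f hx)
  refine ⟨i, hi, j, hj, hij, hf, fun k hk => ⟨fun hkB => ?_, ?_⟩⟩
  · by_contra! hne
    have hinj : Set.InjOn f (A.erase k : Finset α) := by
      rw [← Finset.card_image_iff, hkB, Finset.card_erase_of_mem hk]
      omega
    exact hij (hinj (by simp [hi, hne.1.symm]) (by simp [hj, hne.2.symm]) hf)
  · have key : ∀ a ∈ A, ∀ b ∈ A, a ≠ b → f a = f b → (A.erase a).image f = B := by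
      intro a ha b hb hab hfab
      rw [← h]
      refine (Finset.image_subset_image (Finset.erase_subset _ _)).antisymm ?_
      intro y hy
      obtain ⟨x, hx, rfl⟩ := Finset.mem_image.1 hy
      by_cases hxa : x = a
      · subst hxa
        exact Finset.mem_image.2 ⟨b, by simp [hb, hab.symm], hfab.symm⟩
      · exact Finset.mem_image_of_mem f (by simp [hx, hxa])
    rintro (rfl | rfl)
    · exact key _ hi _ hj hij hf
    · exact key _ hj _ hi hij.symm hf.symm

/-- No element strictly exceeds, in every ranking `r i`, the minimum of `σ`. -/
def Dominant {I T : Type*} (r : I → T → ℕ) (σ : Finset T) : Prop :=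
  ∀ x, ∃ i, ∀ y ∈ σ, r i x ≤ r i y

lemma Dominant.mono {I T : Type*} {r : I → T → ℕ} {σ τ : Finset T} (h : Dominant r σ)
    (hτ : τ ⊆ σ) : Dominant r τ :=
  fun x => (h x).imp fun _ hi y hy => hi y (hτ hy)

/-- `x` is the `r k`-largest element exceeding `m l` in every ranking `l ≠ k`. -/
def IsMaxAbove {I T : Type*} (r : I → T → ℕ) (m : I → T) (k : I) (x : T) : Prop :=
  (∀ l ≠ k, r l (m l) < r l x) ∧ ∀ x', (∀ l ≠ k, r l (m l) < r l x') → r k x' ≤ r k x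

lemma IsMaxAbove.unique {I T : Type*} {r : I → T → ℕ} (hr : ∀ i, Function.Injective (r i))
    {m : I → T} {k : I} {x y : T} (hx : IsMaxAbove r m k x) (hy : IsMaxAbove r m k y) : x = y :=
  hr k (le_antisymm (hy.2 x hx.1) (hx.2 y hy.1))

lemma IsMaxAbove.exists {I T : Type*} [Finite T] {r : I → T → ℕ} {m : I → T} {k : I} {x : T}
    (hx : ∀ l ≠ k, r l (m l) < r l x) : ∃ y, IsMaxAbove r m k y := by
  obtain ⟨y, hy, hmax⟩ := Set.exists_max_image {x | ∀ l ≠ k, r l (m l) < r l x} (r k)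
    (Set.toFinite _) ⟨x, hx⟩
  exact ⟨y, hy, hmax⟩

lemma Dominant.image_argmin {I T : Type*} [Fintype I] [DecidableEq T] {r : I → T → ℕ}
    (hr : ∀ i, Function.Injective (r i)) {τ : Finset T} (hdom : Dominant r τ) {m : I → T}
    (hm : ∀ i, m i ∈ τ ∧ ∀ y ∈ τ, r i (m i) ≤ r i y) : Finset.univ.image m = τ := by
  refine Finset.Subset.antisymm (Finset.image_subset_iff.2 fun i _ => (hm i).1) fun y hy => ?_
  obtain ⟨i, hi⟩ := hdom y
  exact Finset.mem_image.2
    ⟨i, Finset.mem_univ _, hr i (le_antisymm ((hm i).2 y hy) (hi _ (hm i).1))⟩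

/-- Among the one-element extensions of a dominant set with one element less than there are
rankings, exactly the two top elements for the doubly used minimum give dominant sets. -/
lemma Dominant.exists_insert_iff {I T : Type*} [Fintype I] [DecidableEq I] [DecidableEq T]
    {r : I → T → ℕ} (hr : ∀ i, Function.Injective (r i)) {τ : Finset T} (hdom : Dominant r τ)
    (hc : Fintype.card I = τ.card + 1) {m : I → T}
    (hm : ∀ i, m i ∈ τ ∧ ∀ y ∈ τ, r i (m i) ≤ r i y) :
    ∃ i j, i ≠ j ∧ m i = m j ∧ (∀ x, ¬ (IsMaxAbove r m i x ∧ IsMaxAbove r m j x)) ∧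
      ∀ x, (x ∉ τ ∧ Dominant r (insert x τ)) ↔ (IsMaxAbove r m i x ∨ IsMaxAbove r m j x) := by
  have himg := hdom.image_argmin hr hm
  obtain ⟨i, -, j, -, hij, hmij, hE⟩ := Finset.exists_pair_of_image_eq himg
    (by rw [Finset.card_univ, hc])
  replace hE := fun k => hE k (Finset.mem_univ k)
  have key : ∀ k x, (k = i ∨ k = j) → IsMaxAbove r m k x → x ∉ τ ∧ Dominant r (insert x τ) := by
    intro k x hk hx
    have hsurj := (hE k).2 hk
    constructor
    · intro hxτ
      rw [← hsurj] at hxτ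
      obtain ⟨p, hp, hpx⟩ := Finset.mem_image.1 hxτ
      have := hx.1 p (Finset.ne_of_mem_erase hp)
      rw [hpx] at this
      exact lt_irrefl _ this
    · intro t
      by_cases ht : ∀ l ≠ k, r l (m l) < r l t
      · obtain ⟨l, hl⟩ := hdom t
        have hlk : l = k := by
          by_contra hlk
          exact absurd (hl _ (hm l).1) (not_le.2 (ht l hlk))
        subst hlk
        refine ⟨l, fun y hy => ?_⟩
        rcases Finset.mem_insert.1 hy with rfl | hy
        · exact hx.2 t ht
        · exact hl y hy
      · push Not at ht
        obtain ⟨l, hlk, hl⟩ := ht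
        refine ⟨l, fun y hy => ?_⟩
        rcases Finset.mem_insert.1 hy with rfl | hy
        · exact hl.trans (hx.1 l hlk).le
        · exact hl.trans ((hm l).2 y hy)
  refine ⟨i, j, hij, hmij, ?_, fun x => ⟨?_, ?_⟩⟩
  · rintro x ⟨hi, hj⟩
    obtain ⟨l, hl⟩ := hdom x
    have := hl _ (hm l).1
    by_cases hli : l = i
    · exact absurd this (not_le.2 (hj.1 l (hli ▸ hij)))
    · exact absurd this (not_le.2 (hi.1 l hli))
  · rintro ⟨hxτ, hd⟩
    obtain ⟨k, hk⟩ := hd x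
    have hkey : ∀ y ∈ τ, ∃ p, m p = y ∧ r p y < r p x := by
      intro y hy
      obtain ⟨p, hp⟩ := hd y
      refine ⟨p, hr p (le_antisymm ((hm p).2 y hy)
        (hp _ (Finset.mem_insert_of_mem (hm p).1))), ?_⟩
      refine lt_of_le_of_ne (hp x (Finset.mem_insert_self _ _)) fun h => ?_
      exact hxτ (hr p h ▸ hy)
    have hxk : ∀ y ∈ τ, r k x ≤ r k y := fun y hy => hk y (Finset.mem_insert_of_mem hy)
    have hM : ∀ l ≠ k, r l (m l) < r l x := by
      intro l hlk
      by_contra! hl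
      have hsub : τ ⊆ ((Finset.univ.erase k).erase l).image m := by
        intro y hy
        obtain ⟨p, hp, hpx⟩ := hkey y hy
        refine Finset.mem_image.2 ⟨p, ?_, hp⟩
        simp only [Finset.mem_erase, Finset.mem_univ, and_true]
        constructor
        · rintro rfl
          rw [← hp] at hpx
          omega
        · rintro rfl
          have := hxk y hy
          omega
      have h1 := (Finset.card_le_card hsub).trans Finset.card_image_le
      rw [Finset.card_erase_of_mem (by simp [hlk]), Finset.card_erase_of_mem (by simp),
        Finset.card_univ] at h1
      have := Finset.card_pos.2 ⟨_, (hm k).1⟩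
      omega
    have hT : IsMaxAbove r m k x := by
      refine ⟨hM, fun x' hx' => ?_⟩
      obtain ⟨p, hp⟩ := hd x'
      have hpk : p = k := by
        by_contra hpk
        exact absurd (hp _ (Finset.mem_insert_of_mem (hm p).1)) (not_le.2 (hx' p hpk))
      exact hpk ▸ hp x (Finset.mem_insert_self _ _)
    have : k = i ∨ k = j := by
      rw [← hE k]
      refine Finset.Subset.antisymm ((Finset.image_subset_image (Finset.erase_subset _ _)).trans
        himg.le) fun y hy => ?_
      obtain ⟨p, hp, hpx⟩ := hkey y hy
      refine Finset.mem_image.2 ⟨p, ?_, hp⟩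
      simp only [Finset.mem_erase, Finset.mem_univ, and_true]
      rintro rfl
      have := hxk y hy
      omega
    rcases this with rfl | rfl
    · exact Or.inl hT
    · exact Or.inr hT
  · rintro (h | h)
    · exact key i x (Or.inl rfl) h
    · exact key j x (Or.inr rfl) h

/-- A combinatorial Sperner lemma of Scarf type: if the elements `s i` are minimal in the `i`-th
ranking and above all ordinary elements in the other rankings, and `s i` has colour `i`, then there
is a dominant set carrying every colour exactly once. -/
theorem exists_dominant_rainbow {I T : Type*} [Fintype I] [DecidableEq I] [Fintype T]
    [DecidableEq T] {r : I → T → ℕ} (hr : ∀ i, Function.Injective (r i))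
    (hI : 2 ≤ Fintype.card I) (s : I → T) (hmin : ∀ i x, r i (s i) ≤ r i x)
    (hbig : ∀ i j, j ≠ i → ∀ x, (∀ k, x ≠ s k) → r i x < r i (s j))
    (c : T → I) (hcs : ∀ i, c (s i) = i) :
    ∃ σ : Finset T, Dominant r σ ∧ σ.card = Fintype.card I ∧ σ.image c = Finset.univ := by
  classical
  by_contra! hno
  have hsinj : Function.Injective s := fun i j h => by rw [← hcs i, h, hcs]
  obtain ⟨i₀⟩ : Nonempty I := Fintype.card_pos_iff.1 (by omega)
  set D : Finset (Finset T) := Finset.univ.filter fun τ =>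
    Dominant r τ ∧ τ.card + 1 = Fintype.card I ∧ τ.image c = Finset.univ.erase i₀ with hD
  set R : Finset (Finset T) := Finset.univ.filter fun σ =>
    Dominant r σ ∧ σ.card = Fintype.card I with hR
  set X : Finset T → Finset T := fun τ => Finset.univ.filter fun x =>
    x ∉ τ ∧ Dominant r (insert x τ) with hX
  set Y : Finset T → Finset T := fun σ => σ.filter fun x =>
    (σ.erase x).image c = Finset.univ.erase i₀ with hY
  have hcount : ∑ τ ∈ D, (X τ).card = ∑ σ ∈ R, (Y σ).card := by
    rw [← Finset.card_sigma, ← Finset.card_sigma]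
    refine Finset.card_nbij' (fun p => ⟨insert p.2 p.1, p.2⟩) (fun p => ⟨p.1.erase p.2, p.2⟩)
      ?_ ?_ ?_ ?_
    · rintro ⟨τ, x⟩ h
      simp only [hD, hX, hR, hY, Finset.coe_sigma, Set.mem_sigma_iff, Finset.mem_coe,
        Finset.mem_filter, Finset.mem_univ, true_and] at h ⊢
      obtain ⟨⟨h1, h2, h3⟩, h4, h5⟩ := h
      refine ⟨⟨h5, by rw [Finset.card_insert_of_notMem h4, h2]⟩, Finset.mem_insert_self _ _, ?_⟩
      rw [Finset.erase_insert h4, h3]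
    · rintro ⟨σ, x⟩ h
      simp only [hD, hX, hR, hY, Finset.coe_sigma, Set.mem_sigma_iff, Finset.mem_coe,
        Finset.mem_filter, Finset.mem_univ, true_and] at h ⊢
      obtain ⟨⟨h1, h2⟩, h3, h4⟩ := h
      refine ⟨⟨h1.mono (Finset.erase_subset _ _), ?_, h4⟩, by simp, ?_⟩
      · rw [Finset.card_erase_add_one h3, h2]
      · rwa [Finset.insert_erase h3]
    · rintro ⟨τ, x⟩ h
      simp only [hX, Finset.coe_sigma, Set.mem_sigma_iff, Finset.mem_coe,
        Finset.mem_filter, Finset.mem_univ, true_and] at h ⊢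
      rw [Finset.erase_insert h.2.1]
    · rintro ⟨σ, x⟩ h
      simp only [hY, Finset.coe_sigma, Set.mem_sigma_iff, Finset.mem_coe,
        Finset.mem_filter] at h ⊢
      rw [Finset.insert_erase h.2.1]
  have hYeven : ∀ σ ∈ R, Even (Y σ).card := by
    intro σ hσ
    obtain ⟨hσd, hσc⟩ := (Finset.mem_filter.1 hσ).2
    rcases (Y σ).eq_empty_or_nonempty with h | ⟨x, hx⟩
    · simp [h]
    obtain ⟨hxσ, hx⟩ := Finset.mem_filter.1 hx
    have himg : σ.image c = Finset.univ.erase i₀ := by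
      have h1 : σ.image c = insert (c x) (Finset.univ.erase i₀) := by
        rw [← hx, ← Finset.image_insert, Finset.insert_erase hxσ]
      by_cases hcx : c x = i₀
      · exact absurd (by rw [h1, hcx, Finset.insert_erase (Finset.mem_univ _)]) (hno σ hσd hσc)
      · rw [h1, Finset.insert_eq_of_mem (by simp [hcx])]
    obtain ⟨i, hi, j, hj, hij, -, hE⟩ := Finset.exists_pair_of_image_eq himg
      (by rw [Finset.card_erase_of_mem (Finset.mem_univ _), Finset.card_univ, hσc]; omega)
    have : Y σ = {i, j} := by
      ext k
      simp only [hY, Finset.mem_filter, Finset.mem_insert, Finset.mem_singleton]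
      constructor
      · rintro ⟨hk, h⟩
        exact (hE k hk).1 h
      · intro h
        have hk : k ∈ σ := by rcases h with rfl | rfl <;> assumption
        exact ⟨hk, (hE k hk).2 h⟩
    rw [this, Finset.card_pair hij]
    exact even_two
  have hnonempty : ∀ τ ∈ D, τ.Nonempty := by
    intro τ hτ
    obtain ⟨-, hτc, -⟩ := (Finset.mem_filter.1 hτ).2
    exact Finset.card_pos.1 (by omega)
  have hargmin : ∀ τ : Finset T, τ.Nonempty →
      ∃ m : I → T, ∀ i, m i ∈ τ ∧ ∀ y ∈ τ, r i (m i) ≤ r i y := by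
    intro τ hτ
    choose m hm using fun i => Finset.exists_min_image τ (r i) hτ
    exact ⟨m, hm⟩
  set τ₀ : Finset T := (Finset.univ.erase i₀).image s with hτ₀
  have hτ₀card : τ₀.card + 1 = Fintype.card I := by
    rw [hτ₀, Finset.card_image_of_injective _ hsinj, Finset.card_erase_add_one (Finset.mem_univ _),
      Finset.card_univ]
  have hmem₀ : ∀ y, y ∈ τ₀ ↔ ∃ j, j ≠ i₀ ∧ s j = y := by simp [hτ₀]
  have hτ₀D : τ₀ ∈ D := by
    refine Finset.mem_filter.2 ⟨Finset.mem_univ _, ?_, hτ₀card, ?_⟩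
    · intro x
      by_cases hx : ∃ k, x = s k
      · obtain ⟨k, rfl⟩ := hx
        exact ⟨k, fun y _ => hmin k y⟩
      · push Not at hx
        refine ⟨i₀, fun y hy => ?_⟩
        obtain ⟨j, hj, rfl⟩ := (hmem₀ y).1 hy
        exact (hbig i₀ j hj x hx).le
    · rw [hτ₀, Finset.image_image]
      rw [(funext hcs : c ∘ s = id), Finset.image_id]
  have hX₀ : (X τ₀).card = 1 := by
    obtain ⟨m, hm⟩ := hargmin τ₀ (hnonempty _ hτ₀D)
    obtain ⟨hd, -, -⟩ := (Finset.mem_filter.1 hτ₀D).2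
    obtain ⟨i, j, hij, hmij, -, hE⟩ := hd.exists_insert_iff hr hτ₀card.symm hm
    have hms : ∀ l ≠ i₀, m l = s l := fun l hl =>
      hr l (le_antisymm ((hm l).2 _ ((hmem₀ _).2 ⟨l, hl, rfl⟩)) (hmin _ _))
    have hempty : ∀ k x, k ≠ i₀ → m k = m i₀ → ¬ IsMaxAbove r m k x := by
      intro k x hk hmk hx
      rw [hms k hk] at hmk
      have h0 := hx.1 i₀ hk.symm
      rw [← hmk] at h0
      by_cases hxs : ∃ l, x = s l
      · obtain ⟨l, rfl⟩ := hxs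
        by_cases hl0 : l = i₀
        · subst hl0
          exact absurd h0 (not_lt.2 (hmin _ _))
        by_cases hlk : l = k
        · subst hlk
          exact lt_irrefl _ h0
        have := hx.1 l hlk
        rw [hms l hl0] at this
        exact lt_irrefl _ this
      · push Not at hxs
        exact absurd h0 (not_lt.2 (hbig i₀ k hk x hxs).le)
    have htop : ∃ y, IsMaxAbove r m i₀ y := by
      refine IsMaxAbove.exists (x := s i₀) fun l hl => ?_
      rw [hms l hl]
      exact lt_of_le_of_ne (hmin _ _) fun h => hl (hsinj (hr l h))
    obtain ⟨y, hy⟩ := htop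
    have hiff : ∀ x, (x ∉ τ₀ ∧ Dominant r (insert x τ₀)) ↔ IsMaxAbove r m i₀ x := by
      intro x
      rw [hE x]
      by_cases hi : i = i₀
      · subst hi
        exact ⟨fun h => h.resolve_right (hempty j x hij.symm hmij.symm), Or.inl⟩
      by_cases hj : j = i₀
      · subst hj
        exact ⟨fun h => h.resolve_left (hempty i x hij hmij), Or.inr⟩
      rw [hms i hi, hms j hj] at hmij
      exact absurd (hsinj hmij) hij
    refine Finset.card_eq_one.2 ⟨y, ?_⟩
    ext x
    simp only [hX, Finset.mem_filter, Finset.mem_univ, true_and, Finset.mem_singleton, hiff]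
    exact ⟨fun h => h.unique hr hy, fun h => h ▸ hy⟩
  have hXeven : ∀ τ ∈ D.erase τ₀, Even (X τ).card := by
    intro τ hτ
    obtain ⟨hne, hτ⟩ := Finset.mem_erase.1 hτ
    obtain ⟨m, hm⟩ := hargmin τ (hnonempty _ hτ)
    obtain ⟨hd, hτc, himg⟩ := (Finset.mem_filter.1 hτ).2
    obtain ⟨i, j, hij, hmij, hdisj, hE⟩ := hd.exists_insert_iff hr hτc.symm hm
    have hsmall : ∀ l, ∃ y ∈ τ, ∀ j, j ≠ l → y ≠ s j := by
      intro l
      by_contra! hl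
      have hsub : τ ⊆ (Finset.univ.erase l).image s := by
        intro y hy
        obtain ⟨j, hj, rfl⟩ := hl y hy
        exact Finset.mem_image_of_mem s (by simp [hj])
      have hl0 : l = i₀ := by
        by_contra hl0
        have : l ∈ τ.image c := by rw [himg]; simp [hl0]
        obtain ⟨y, hy, hyl⟩ := Finset.mem_image.1 this
        obtain ⟨j, hj, rfl⟩ := hl y hy
        exact hj (by rw [← hcs j, hyl])
      subst hl0
      exact hne (Finset.eq_of_subset_of_card_le hsub (by omega))
    have hlt : ∀ l k, k ≠ l → r l (m l) < r l (s k) := by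
      intro l k hkl
      obtain ⟨y, hy, hys⟩ := hsmall l
      refine lt_of_le_of_lt ((hm l).2 y hy) ?_
      by_cases hyl : y = s l
      · rw [hyl]
        exact lt_of_le_of_ne (hmin _ _) fun h => hkl (hsinj (hr l h)).symm
      · refine hbig l k hkl y fun p hp => ?_
        by_cases hpl : p = l
        · exact hyl (hpl ▸ hp)
        · exact hys p hpl hp
    have htop : ∀ k, ∃ y, IsMaxAbove r m k y := fun k =>
      IsMaxAbove.exists (x := s k) fun l hl => hlt l k hl.symm
    obtain ⟨a, ha⟩ := htop i
    obtain ⟨b, hb⟩ := htop j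
    have hab : a ≠ b := fun h => hdisj a ⟨ha, h ▸ hb⟩
    have : X τ = {a, b} := by
      ext x
      simp only [hX, Finset.mem_filter, Finset.mem_univ, true_and, hE, Finset.mem_insert,
        Finset.mem_singleton]
      constructor
      · rintro (h | h)
        · exact Or.inl (h.unique hr ha)
        · exact Or.inr (h.unique hr hb)
      · rintro (rfl | rfl)
        · exact Or.inl ha
        · exact Or.inr hb
    rw [this, Finset.card_pair hab]
    exact even_two
  have h1 : Even (∑ σ ∈ R, (Y σ).card) := Finset.even_sum _ hYeven
  rw [← hcount, ← Finset.add_sum_erase D _ hτ₀D, hX₀, Nat.even_add] at h1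
  exact absurd (h1.2 (Finset.even_sum _ hXeven)) (by decide)
/-- Discrete Sperner lemma on the grid of `ℕ`-valued points with coordinate sum `N`. -/
theorem exists_grid_near_rainbow {I : Type*} [Fintype I] [DecidableEq I]
    (hI : 2 ≤ Fintype.card I) (N : ℕ) (c : (I → ℕ) → I) :
    ∃ a : I → ℕ, ∑ i, a i = N ∧ ∀ i, a i ≤ Fintype.card I ∨
      ∃ b : I → ℕ, ∑ j, b j = N ∧ c b = i ∧
        ∀ j, a j ≤ b j + Fintype.card I ∧ b j ≤ a j + Fintype.card I := by
  classical
  let G := {a : I → ℕ // a ∈ Finset.piAntidiag Finset.univ N}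
  have : Fintype G := inferInstanceAs (Fintype (Finset.piAntidiag (Finset.univ : Finset I) N))
  have hG : ∀ a : G, ∑ i, a.1 i = N := fun a => (Finset.mem_piAntidiag.1 a.2).1
  let h : I → G ⊕ I → ℕ := fun i => Sum.elim (fun a => a.1 i + 1) fun j => if j = i then 0 else N + 2
  let e := Fintype.equivFin (G ⊕ I)
  let K := Fintype.card (G ⊕ I)
  let r : I → G ⊕ I → ℕ := fun i t => h i t * K + e t
  have hlt : ∀ i t u, h i t < h i u → r i t < r i u := by
    intro i t u htu
    calc r i t < h i t * K + K := Nat.add_lt_add_left (e t).2 _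
      _ = (h i t + 1) * K := by ring
      _ ≤ h i u * K := Nat.mul_le_mul_right _ htu
      _ ≤ r i u := Nat.le_add_right _ _
  have hr : ∀ i, Function.Injective (r i) := by
    intro i t u htu
    have hh : h i t = h i u := le_antisymm
      (not_lt.1 fun hl => (hlt i _ _ hl).ne' htu) (not_lt.1 fun hl => (hlt i _ _ hl).ne htu)
    simp only [r, hh] at htu
    exact e.injective (Fin.ext (Nat.add_left_cancel htu))
  have hle : ∀ i (a : G), a.1 i ≤ N := fun i a =>
    (Finset.single_le_sum (fun _ _ => Nat.zero_le _) (Finset.mem_univ i)).trans (hG a).le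
  obtain ⟨σ, hσ, hσc, himg⟩ := exists_dominant_rainbow hr hI Sum.inr
    (by
      intro i x
      by_cases hx : x = Sum.inr i
      · rw [hx]
      · refine (hlt _ _ _ ?_).le
        rcases x with a | j
        · simp [h]
        · have : j ≠ i := fun hj => hx (by rw [hj])
          simp [h, this])
    (by
      intro i j hj x hx
      rcases x with a | k
      · refine hlt _ _ _ ?_
        have := hle i a
        simp only [h, Sum.elim_inl, Sum.elim_inr, if_neg hj]
        omega
      · exact absurd rfl (hx k))
    (Sum.elim (fun a => c a.1) id) (fun i => rfl)
  have hdom : ∀ t : I → ℕ, ∑ i, t i = N →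
      ∃ i, Sum.inr i ∉ σ ∧ ∀ a : G, Sum.inl a ∈ σ → t i ≤ a.1 i := by
    intro t ht
    obtain ⟨i, hi⟩ := hσ (Sum.inl ⟨t, by simp [ht]⟩)
    refine ⟨i, fun his => ?_, fun a ha => ?_⟩
    · exact absurd (hi _ his) (not_le.2 (hlt _ _ _ (by simp [h])))
    · by_contra! hlt'
      exact absurd (hi _ ha) (not_le.2 (hlt _ _ _ (by simpa [h] using hlt')))
  have hcol : ∀ i, Sum.inr i ∉ σ → ∃ b : G, Sum.inl b ∈ σ ∧ c b.1 = i := by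
    intro i hi
    have : i ∈ σ.image (Sum.elim (fun a : G => c a.1) id) := by
      rw [himg]
      exact Finset.mem_univ i
    obtain ⟨b | j, hb, hbi⟩ := Finset.mem_image.1 this
    · exact ⟨b, hb, hbi⟩
    · simp only [Sum.elim_inr, id] at hbi
      exact absurd (hbi ▸ hb) hi
  obtain ⟨i₁⟩ : Nonempty I := Fintype.card_pos_iff.1 (by omega)
  obtain ⟨i₀, hi₀, -⟩ := hdom (Pi.single i₁ N) (by simp)
  obtain ⟨a, ha, -⟩ := hcol i₀ hi₀
  set C : Finset I := Finset.univ.filter fun i => Sum.inr i ∉ σ with hC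
  have hmC : ∀ i, i ∈ C ↔ Sum.inr i ∉ σ := by simp [hC]
  have hminex : ∀ j, ∃ b : G, Sum.inl b ∈ σ ∧ ∀ a : G, Sum.inl a ∈ σ → b.1 j ≤ a.1 j := by
    intro j
    obtain ⟨b, hb, hbm⟩ := Finset.exists_min_image
      (Finset.univ.filter fun a : G => Sum.inl a ∈ σ) (fun a => a.1 j) ⟨a, by simpa using ha⟩
    simp only [Finset.mem_filter, Finset.mem_univ, true_and] at hb hbm
    exact ⟨b, hb, hbm⟩
  choose b hbσ hbmin using hminex
  set m : I → ℕ := fun j => (b j).1 j with hm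
  have hsum : N < ∑ j ∈ C, (m j + 1) := by
    by_contra! hle
    set t : I → ℕ := fun j => (if j ∈ C then m j + 1 else 0) +
      if j = i₀ then N - ∑ j ∈ C, (m j + 1) else 0 with ht
    have htsum : ∑ j, t j = N := by
      simp only [ht, Finset.sum_add_distrib, Finset.sum_ite_eq', Finset.mem_univ, if_true,
        Finset.sum_ite_mem, Finset.univ_inter]
      simp only [Finset.sum_add_distrib] at hle
      omega
    obtain ⟨i, hi, hit⟩ := hdom t htsum
    have := hit _ (hbσ i)
    simp only [ht, (hmC i).2 hi, if_true, hm] at this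
    omega
  have hCc : C.card ≤ Fintype.card I := Finset.card_le_univ C
  simp only [Finset.sum_add_distrib, Finset.sum_const, smul_eq_mul, mul_one] at hsum
  have hin : ∀ j ∈ C, ∀ x : G, Sum.inl x ∈ σ → m j ≤ x.1 j ∧ x.1 j ≤ m j + Fintype.card I := by
    intro j hj x hx
    refine ⟨hbmin j x hx, ?_⟩
    have h1 : ∑ k ∈ C, x.1 k ≤ N :=
      (Finset.sum_le_sum_of_subset (Finset.subset_univ _)).trans (hG x).le
    have h2 : ∑ k ∈ C.erase j, m k ≤ ∑ k ∈ C.erase j, x.1 k :=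
      Finset.sum_le_sum fun k _ => hbmin k x hx
    rw [← Finset.add_sum_erase C _ hj] at h1 hsum
    omega
  have hout : ∀ j ∉ C, ∀ x : G, Sum.inl x ∈ σ → x.1 j ≤ Fintype.card I := by
    intro j hj x hx
    have h1 : ∑ k ∈ insert j C, x.1 k ≤ N :=
      (Finset.sum_le_sum_of_subset (Finset.subset_univ _)).trans (hG x).le
    rw [Finset.sum_insert hj] at h1
    have h2 : ∑ k ∈ C, m k ≤ ∑ k ∈ C, x.1 k := Finset.sum_le_sum fun k _ => hbmin k x hx
    omega
  refine ⟨a.1, hG a, fun i => ?_⟩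
  by_cases hi : i ∈ C
  · right
    obtain ⟨d, hd, hdc⟩ := hcol i ((hmC i).1 hi)
    refine ⟨d.1, hG d, hdc, fun j => ?_⟩
    by_cases hj : j ∈ C
    · have := hin j hj a ha
      have := hin j hj d hd
      omega
    · have := hout j hj a ha
      have := hout j hj d hd
      omega
  · exact Or.inl (hout i hi a ha)

/-- Dual KKM theorem: closed sets covering the standard simplex, the `i`-th of which contains the
`i`-th facet, have a common point in the simplex. -/
theorem exists_mem_iInter_of_facet_cover {I : Type*} [Fintype I] [DecidableEq I]
    (hI : 2 ≤ Fintype.card I) (B : I → Set (I → ℝ)) (hB : ∀ i, IsClosed (B i))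
    (hfacet : ∀ x ∈ stdSimplex ℝ I, ∀ i, x i = 0 → x ∈ B i)
    (hcover : ∀ x ∈ stdSimplex ℝ I, ∃ i, x ∈ B i) :
    ∃ x ∈ stdSimplex ℝ I, ∀ i, x ∈ B i := by
  classical
  by_contra! hno
  obtain ⟨δ, hδ, hball⟩ := lebesgue_number_lemma_of_metric
    (c := fun i => (B i)ᶜ ∩ {x | 0 < x i}) (isCompact_stdSimplex ℝ I)
    (fun i => (hB i).isOpen_compl.inter (isOpen_lt continuous_const (continuous_apply i)))
    (by
      intro x hx
      obtain ⟨i, hi⟩ := hno x hx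
      exact Set.mem_iUnion.2 ⟨i, hi, lt_of_le_of_ne (hx.1 i) fun h => hi (hfacet x hx i h.symm)⟩)
  obtain ⟨N, hN⟩ := exists_nat_gt (Fintype.card I / δ)
  have hNpos : (0 : ℝ) < N := lt_of_le_of_lt (by positivity) hN
  have hδN : Fintype.card I / (N : ℝ) < δ := by
    rw [div_lt_iff₀ hδ] at hN
    rw [div_lt_iff₀ hNpos]
    linarith
  set p : (I → ℕ) → I → ℝ := fun a i => a i / N with hp
  have hpmem : ∀ a : I → ℕ, ∑ i, a i = N → p a ∈ stdSimplex ℝ I := by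
    intro a ha
    refine ⟨fun i => by positivity, ?_⟩
    rw [← Finset.sum_div, ← Nat.cast_sum, ha, div_self hNpos.ne']
  have hcol : ∀ a : I → ℕ, ∃ i, ∑ i, a i = N → p a ∈ B i := by
    intro a
    by_cases ha : ∑ i, a i = N
    · exact (hcover _ (hpmem a ha)).imp fun i hi _ => hi
    · obtain ⟨i⟩ : Nonempty I := Fintype.card_pos_iff.1 (by omega)
      exact ⟨i, fun h => absurd h ha⟩
  choose c hc using hcol
  obtain ⟨a, ha, hnear⟩ := exists_grid_near_rainbow hI N c
  obtain ⟨i, hi⟩ := hball _ (hpmem a ha)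
  rcases hnear i with hai | ⟨b, hb, hbi, hab⟩
  · have : Function.update (p a) i 0 ∈ Metric.ball (p a) δ := by
      rw [Metric.mem_ball, dist_pi_lt_iff hδ]
      intro j
      by_cases hj : j = i
      · subst hj
        rw [Function.update_self, dist_zero_left, Real.norm_of_nonneg (by positivity)]
        refine lt_of_le_of_lt ?_ hδN
        have : (a j : ℝ) ≤ Fintype.card I := by exact_mod_cast hai
        simp only [hp]
        gcongr
      · rw [Function.update_of_ne hj, dist_self]
        exact hδ
    have := (hi this).2
    simp at this
  · have : p b ∈ Metric.ball (p a) δ := by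
      rw [Metric.mem_ball, dist_pi_lt_iff hδ]
      intro j
      refine lt_of_le_of_lt ?_ hδN
      have h1 : (a j : ℝ) ≤ b j + Fintype.card I := by exact_mod_cast (hab j).1
      have h2 : (b j : ℝ) ≤ a j + Fintype.card I := by exact_mod_cast (hab j).2
      rw [Real.dist_eq, hp]
      simp only
      rw [← sub_div, abs_div, abs_of_pos hNpos]
      gcongr
      rw [abs_le]
      constructor <;> linarith
    exact (hi this).1 (hbi ▸ hc b hb)
/-- Continuous weights on families of labelled `κ`-tuples, where a label `i` is only used at points
with positive `i`-th coordinate, are balanced at some point of the simplex: for every set `S` of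
labels, some tuple of positive weight uses labels of `S` at least `S.card` times. -/
theorem exists_balanced_labelling {I J κ : Type*} [Fintype I] [DecidableEq I] [Fintype J]
    [Fintype κ] (hI : 2 ≤ Fintype.card I) (hκ : Fintype.card κ = Fintype.card I)
    (w : J → (I → ℝ) → ℝ) (hw : ∀ j, Continuous (w j)) (hw0 : ∀ j y, 0 ≤ w j y)
    (hpos : ∀ y ∈ stdSimplex ℝ I, ∃ j, 0 < w j y) (lab : J → κ → I)
    (hlab : ∀ y ∈ stdSimplex ℝ I, ∀ j, 0 < w j y → ∀ k, y (lab j k) ≠ 0) :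
    ∃ y ∈ stdSimplex ℝ I, ∀ S : Finset I, ∃ j, 0 < w j y ∧
      S.card ≤ (Finset.univ.filter fun k => lab j k ∈ S).card := by
  set W : (I → ℝ) → ℝ := fun y => ∑ j, w j y with hW
  set n : J → I → ℝ := fun j i => ((Finset.univ.filter fun k => lab j k = i).card : ℝ) with hn
  set G : I → (I → ℝ) → ℝ := fun i y => ∑ j, w j y * n j i with hG
  have hnsum : ∀ j (S : Finset I),
      ∑ i ∈ S, n j i = ((Finset.univ.filter fun k => lab j k ∈ S).card : ℝ) := by
    intro j S
    rw [Finset.card_eq_sum_card_fiberwise (f := lab j) (t := S) (by intro k hk; simpa using hk)]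
    push_cast
    refine Finset.sum_congr rfl fun i hi => ?_
    simp only [hn, Finset.filter_filter]
    congr 2
    ext k
    simp only [Finset.mem_filter, Finset.mem_univ, true_and]
    exact ⟨fun h => ⟨h ▸ hi, h⟩, fun h => h.2⟩
  have hWpos : ∀ y ∈ stdSimplex ℝ I, 0 < W y := fun y hy => by
    obtain ⟨j, hj⟩ := hpos y hy
    exact Finset.sum_pos' (fun j _ => hw0 j y) ⟨j, Finset.mem_univ _, hj⟩
  have hGsum : ∀ y (S : Finset I), ∑ i ∈ S, G i y = ∑ j, w j y * ∑ i ∈ S, n j i := by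
    intro y S
    simp only [hG, Finset.mul_sum]
    exact Finset.sum_comm
  have hGtot : ∀ y, ∑ i, G i y = Fintype.card I * W y := by
    intro y
    rw [hGsum, hW, Finset.mul_sum]
    refine Finset.sum_congr rfl fun j _ => ?_
    rw [hnsum]
    simp [hκ, mul_comm]
  have hGzero : ∀ y ∈ stdSimplex ℝ I, ∀ i, y i = 0 → G i y = 0 := by
    intro y hy i hi
    refine Finset.sum_eq_zero fun j _ => ?_
    rcases (hw0 j y).eq_or_lt with h | h
    · rw [← h, zero_mul]
    · have : (Finset.univ.filter fun k => lab j k = i) = ∅ :=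
        Finset.filter_eq_empty_iff.2 fun k _ hk => hlab y hy j h k (hk ▸ hi)
      simp [hn, this]
  have hWc : Continuous W := continuous_finsetSum _ fun j _ => hw j
  have hGc : ∀ i, Continuous (G i) := fun i =>
    continuous_finsetSum _ fun j _ => (hw j).mul continuous_const
  set d : I → (I → ℝ) → ℝ := fun i y => max 0 (W y - G i y) with hd
  have hdc : ∀ i, Continuous (d i) := fun i => continuous_const.max (hWc.sub (hGc i))
  have hd0 : ∀ i y, 0 ≤ d i y := fun i y => le_max_left _ _
  obtain ⟨y, hy, hyB⟩ := exists_mem_iInter_of_facet_cover hI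
    (fun i => {y | y i * ∑ k, d k y ≤ d i y})
    (fun i => isClosed_le ((continuous_apply i).mul (continuous_finsetSum _ fun k _ => hdc k))
      (hdc i))
    (by
      intro x hx i hi
      simp only [Set.mem_ofPred_eq, hi, zero_mul]
      exact hd0 i x)
    (by
      intro x hx
      by_contra! h
      simp only [Set.mem_ofPred_eq, not_le] at h
      have hne : (Finset.univ : Finset I).Nonempty :=
        Finset.card_pos.1 (by rw [Finset.card_univ]; omega)
      have := Finset.sum_lt_sum_of_nonempty hne fun i _ => h i
      rw [← Finset.sum_mul, hx.2, one_mul] at this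
      exact lt_irrefl _ this)
  replace hyB : ∀ i, y i * ∑ k, d k y ≤ d i y := hyB
  have hWG : ∀ i, W y ≤ G i y := by
    have heq : ∀ i, y i * ∑ k, d k y = d i y := by
      have := (Finset.sum_eq_sum_iff_of_le fun i (_ : i ∈ Finset.univ) => hyB i).1
        (by rw [← Finset.sum_mul, hy.2, one_mul])
      exact fun i => this i (Finset.mem_univ i)
    by_contra! hcon
    obtain ⟨i₀, hi₀⟩ := hcon
    have hD : 0 < ∑ k, d k y := Finset.sum_pos' (fun k _ => hd0 k y)
      ⟨i₀, Finset.mem_univ _, lt_max_of_lt_right (sub_pos.2 hi₀)⟩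
    have hlt : ∀ i ∈ Finset.univ, G i y < W y := by
      intro i _
      rcases (hy.1 i).eq_or_lt with h | h
      · rw [hGzero y hy i h.symm]
        exact hWpos y hy
      · have h1 : 0 < d i y := heq i ▸ mul_pos h hD
        rcases lt_max_iff.1 h1 with h2 | h2
        · exact absurd h2 (lt_irrefl _)
        · linarith
    have := Finset.sum_lt_sum_of_nonempty ⟨i₀, Finset.mem_univ _⟩ hlt
    rw [hGtot, Finset.sum_const, Finset.card_univ, nsmul_eq_mul] at this
    exact lt_irrefl _ this
  refine ⟨y, hy, fun S => ?_⟩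
  by_contra! hcon
  have h1 : S.card * W y ≤ ∑ j, w j y * ∑ i ∈ S, n j i := by
    rw [← hGsum, ← nsmul_eq_mul]
    exact Finset.card_nsmul_le_sum _ _ _ fun i _ => hWG i
  have h2 : ∑ j, w j y * ∑ i ∈ S, n j i < ∑ j, w j y * S.card := by
    obtain ⟨j₀, hj₀⟩ := hpos y hy
    refine Finset.sum_lt_sum (fun j _ => ?_) ⟨j₀, Finset.mem_univ _, ?_⟩
    · rcases (hw0 j y).eq_or_lt with h | h
      · rw [← h, zero_mul, zero_mul]
      · rw [hnsum]
        exact mul_le_mul_of_nonneg_left (by exact_mod_cast (hcon j h).le) h.le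
    · rw [hnsum]
      exact mul_lt_mul_of_pos_left (by exact_mod_cast hcon j₀ hj₀) hj₀
  rw [← Finset.sum_mul, mul_comm] at h2
  exact absurd (lt_of_le_of_lt h1 h2) (lt_irrefl _)

/-- **Rado's theorem**: a finite family of finite sets has an independent transversal if the
union of every subfamily has rank at least the size of the subfamily. -/
theorem Matroid.exists_indep_transversal {α I : Type*} [Fintype I] [DecidableEq I] [DecidableEq α]
    (M : Matroid α) (N : I → Finset α)
    (hN : ∀ S : Finset I, (S.card : ℕ∞) ≤ M.eRk (S.biUnion N)) :
    ∃ f : I → α, Function.Injective f ∧ M.Indep (Set.range f) ∧ ∀ i, f i ∈ N i := by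
  induction hs : ∑ i, (N i).card using Nat.strong_induction_on generalizing N with
  | _ s ih =>
  by_cases hbig : ∃ i, 1 < (N i).card
  · obtain ⟨i, hi⟩ := hbig
    obtain ⟨a, ha, b, hb, hab⟩ := Finset.one_lt_card.1 hi
    have hstep : ∀ x ∈ N i,
        (∀ S : Finset I, (S.card : ℕ∞) ≤ M.eRk (S.biUnion (Function.update N i ((N i).erase x)))) →
        ∃ f : I → α, Function.Injective f ∧ M.Indep (Set.range f) ∧ ∀ i, f i ∈ N i := by
      intro x hx h
      have hle : ∀ k, Function.update N i ((N i).erase x) k ⊆ N k := by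
        intro k
        by_cases hk : k = i
        · subst hk
          rw [Function.update_self]
          exact Finset.erase_subset _ _
        · rw [Function.update_of_ne hk]
      obtain ⟨f, hf, hfi, hfN⟩ := ih _ (by
        rw [← hs]
        refine Finset.sum_lt_sum (fun k _ => Finset.card_le_card (hle k))
          ⟨i, Finset.mem_univ _, ?_⟩
        rw [Function.update_self]
        exact Finset.card_erase_lt_of_mem hx) _ h rfl
      exact ⟨f, hf, hfi, fun k => hle k (hfN k)⟩
    by_contra hno
    have hfail : ∀ x ∈ N i, ∃ S : Finset I, i ∉ S ∧
        M.eRk (S.biUnion N ∪ (N i).erase x : Finset α) ≤ S.card := by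
      intro x hx
      have := mt (hstep x hx) hno
      push Not at this
      obtain ⟨S, hS⟩ := this
      have hcongr : ∀ S : Finset I, i ∉ S →
          S.biUnion (Function.update N i ((N i).erase x)) = S.biUnion N := fun S hiS =>
        Finset.biUnion_congr rfl fun k hk =>
          Function.update_of_ne (fun h => hiS (by rwa [h] at hk)) _ _
      have hiS : i ∈ S := by
        by_contra hiS
        rw [hcongr S hiS] at hS
        exact absurd (hN S) (not_le.2 hS)
      refine ⟨S.erase i, Finset.notMem_erase _ _, ?_⟩
      rw [← Finset.insert_erase hiS, Finset.biUnion_insert, Function.update_self,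
        hcongr _ (Finset.notMem_erase _ _), Finset.card_insert_of_notMem (Finset.notMem_erase _ _),
        Finset.union_comm] at hS
      push_cast at hS ⊢
      exact Order.lt_add_one_iff_of_not_isMax (by simp) |>.1 hS
    obtain ⟨S, hiS, hS⟩ := hfail a ha
    obtain ⟨T, hiT, hT⟩ := hfail b hb
    have h1 := hN (insert i (S ∪ T))
    have h2 := hN (S ∩ T)
    rw [Finset.card_insert_of_notMem (by simp [hiS, hiT])] at h1
    have h3 := M.eRk_inter_add_eRk_union_le (S.biUnion N ∪ (N i).erase a : Finset α)
      (T.biUnion N ∪ (N i).erase b : Finset α)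
    have h4 : M.eRk ((insert i (S ∪ T)).biUnion N) ≤
        M.eRk (((S.biUnion N ∪ (N i).erase a : Finset α) : Set α) ∪
          (T.biUnion N ∪ (N i).erase b : Finset α)) := by
      refine M.eRk_mono ?_
      rw [← Finset.coe_union, Finset.coe_subset]
      intro z hz
      simp only [Finset.mem_biUnion, Finset.mem_insert, Finset.mem_union, Finset.mem_erase] at hz ⊢
      grind
    have h5 : M.eRk ((S ∩ T).biUnion N) ≤
        M.eRk (((S.biUnion N ∪ (N i).erase a : Finset α) : Set α) ∩
          (T.biUnion N ∪ (N i).erase b : Finset α)) := by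
      refine M.eRk_mono ?_
      rw [← Finset.coe_inter, Finset.coe_subset]
      intro z hz
      simp only [Finset.mem_biUnion, Finset.mem_inter, Finset.mem_union, Finset.mem_erase] at hz ⊢
      grind
    have h6 := (add_le_add (h2.trans h5) (h1.trans h4)).trans (h3.trans (add_le_add hS hT))
    have h7 : (S ∩ T).card + ((S ∪ T).card + 1) ≤ S.card + T.card := by exact_mod_cast h6
    have := Finset.card_union_add_card_inter S T
    omega
  · push Not at hbig
    have hne : ∀ i, (N i).Nonempty := by
      intro i
      by_contra hi
      rw [Finset.not_nonempty_iff_eq_empty] at hi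
      have := hN {i}
      simp [hi] at this
    choose f hf using hne
    have hsub : ((Finset.univ.biUnion N : Finset α) : Set α) ⊆ Set.range f := by
      intro x hx
      simp only [Finset.coe_biUnion, Finset.coe_univ, Set.mem_univ, Set.iUnion_true,
        Set.mem_iUnion, Finset.mem_coe] at hx
      obtain ⟨i, hi⟩ := hx
      exact ⟨i, Finset.card_le_one.1 (hbig i) _ (hf i) _ hi⟩
    have h1 := (hN Finset.univ).trans (M.eRk_mono hsub)
    obtain ⟨A, hA, hAi, hAc⟩ := M.le_eRk_iff.1 h1
    have hfin : (Set.range f).Finite := Set.finite_range f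
    have h2 : (Set.range f).encard ≤ (Finset.univ : Finset I).card := by
      rw [← Set.image_univ]
      refine (Set.encard_image_le _ _).trans ?_
      rw [← Finset.coe_univ, Set.encard_coe_eq_coe_finsetCard]
    have hAeq : A = Set.range f :=
      (hfin.subset hA).eq_of_subset_of_encard_le hA (h2.trans hAc.ge)
    refine ⟨f, ?_, hAeq ▸ hAi, hf⟩
    rw [← Set.injOn_univ]
    refine Set.finite_univ.injOn_of_encard_image_eq ?_
    rw [Set.image_univ, ← hAeq, hAc, ← Set.encard_coe_eq_coe_finsetCard, Finset.coe_univ]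

/-- The signed position of `s` relative to the chord of the circle of radius `R` joining the points
at angles `2 * a` and `2 * b` (a tangent if these points coincide). -/
noncomputable def chord (R a b : ℝ) (s : EuclideanSpace ℝ (Fin 2)) : ℝ :=
  s 0 * Real.cos (a + b) + s 1 * Real.sin (a + b) - R * Real.cos (b - a)

lemma chord_add_pi (R a b : ℝ) (s : EuclideanSpace ℝ (Fin 2)) :
    chord R b (a + Real.pi) s = - chord R a b s := by
  unfold chord
  rw [show b + (a + Real.pi) = a + b + Real.pi by ring,
    show a + Real.pi - b = Real.pi - (b - a) by ring, Real.cos_add_pi, Real.sin_add_pi,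
    Real.cos_pi_sub]
  ring

lemma continuous_chord (R a b : ℝ) : Continuous (chord R a b) := by
  unfold chord
  fun_prop

lemma convex_chord_pos (R a b : ℝ) : Convex ℝ {s | 0 < chord R a b s} := by
  have h := convex_halfSpace_gt (𝕜 := ℝ)
    (f := fun s : EuclideanSpace ℝ (Fin 2) => s 0 * Real.cos (a + b) + s 1 * Real.sin (a + b))
    ⟨fun x y => by simp only [PiLp.add_apply]; ring,
      fun c x => by simp only [PiLp.smul_apply, smul_eq_mul]; ring⟩ (R * Real.cos (b - a))
  simpa only [chord, sub_pos] using h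

lemma convex_chord_neg (R a b : ℝ) : Convex ℝ {s | chord R a b s < 0} := by
  simpa only [chord_add_pi, neg_pos] using convex_chord_pos R b (a + Real.pi)

/-- Enlarging an arc at one end enlarges its cap of the open disc. -/
lemma chord_pos_of_le {R a b b' : ℝ} {s : EuclideanSpace ℝ (Fin 2)} (hs : ‖s‖ < R) (hab : a ≤ b)
    (hb : b ≤ b') (hb' : b' - a ≤ Real.pi) (h : 0 < chord R a b s) : 0 < chord R a b' s := by
  set A := s 0 * Real.cos (2 * a) + s 1 * Real.sin (2 * a) with hA
  set B := s 1 * Real.cos (2 * a) - s 0 * Real.sin (2 * a) with hB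
  have hchord : ∀ c, chord R a c s = B * Real.sin (c - a) - (R - A) * Real.cos (c - a) := by
    intro c
    rw [chord, show a + c = 2 * a + (c - a) by ring, Real.cos_add, Real.sin_add, hA, hB]
    ring
  have hAR : A < R := by
    have h1 : A ^ 2 ≤ ‖s‖ ^ 2 := by
      rw [EuclideanSpace.norm_sq_eq, Fin.sum_univ_two, Real.norm_eq_abs, Real.norm_eq_abs, sq_abs,
        sq_abs]
      have h2 : A ^ 2 + B ^ 2 = s 0 ^ 2 + s 1 ^ 2 := by
        have := Real.sin_sq_add_cos_sq (2 * a)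
        rw [hA, hB]
        linear_combination (s 0 ^ 2 + s 1 ^ 2) * this
      nlinarith [sq_nonneg B]
    exact lt_of_le_of_lt (abs_le_of_sq_le_sq' h1 (norm_nonneg s)).2 hs
  rw [hchord] at h ⊢
  set u := b - a with hu
  set v := b' - a with hv
  have hu0 : 0 ≤ u := by linarith
  have huv : u ≤ v := by linarith
  rcases hu0.eq_or_lt with h0 | hu0
  · rw [← h0, Real.sin_zero, Real.cos_zero] at h
    linarith
  rcases hb'.eq_or_lt with hpi | hpi
  · rw [hpi, Real.sin_pi, Real.cos_pi]
    linarith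
  have hsu : 0 < Real.sin u := Real.sin_pos_of_pos_of_lt_pi hu0 (by linarith)
  have hsv : 0 < Real.sin v := Real.sin_pos_of_pos_of_lt_pi (by linarith) hpi
  have hsd : 0 ≤ Real.sin (v - u) :=
    Real.sin_nonneg_of_nonneg_of_le_pi (by linarith) (by linarith)
  rw [Real.sin_sub] at hsd
  have h1 : 0 < (B * Real.sin v - (R - A) * Real.cos v) * Real.sin u := by
    have := mul_pos h hsv
    have := mul_nonneg (sub_pos.2 hAR).le hsd
    linarith
  exact (mul_pos_iff_of_pos_right hsu).1 h1

lemma isLine_chord (R a b : ℝ) : IsLine {s | chord R a b s = 0} := by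
  set c := Real.cos (a + b) with hc
  set d := Real.sin (a + b) with hd
  set k := R * Real.cos (b - a) with hk
  have hcd : d ^ 2 + c ^ 2 = 1 := Real.sin_sq_add_cos_sq _
  refine ⟨AffineSubspace.mk' !₂[k * c, k * d] (Submodule.span ℝ {!₂[-d, c]}), ?_, ?_⟩
  · rw [AffineSubspace.direction_mk']
    refine finrank_span_singleton fun h => ?_
    have h0 := congrArg (fun v : EuclideanSpace ℝ (Fin 2) => v 0) h
    have h1 := congrArg (fun v : EuclideanSpace ℝ (Fin 2) => v 1) h
    simp at h0 h1
    simp [h0, h1] at hcd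
  · ext s
    rw [SetLike.mem_coe, AffineSubspace.mem_mk', Submodule.mem_span_singleton]
    change s 0 * c + s 1 * d - k = 0 ↔ _
    constructor
    · intro h
      refine ⟨s 1 * c - s 0 * d, ?_⟩
      ext i
      fin_cases i
      · simp
        linear_combination s 0 * hcd - c * h
      · simp
        linear_combination s 1 * hcd - d * h
    · rintro ⟨t, ht⟩
      have h0 := congrArg (fun v : EuclideanSpace ℝ (Fin 2) => v 0) ht
      have h1 := congrArg (fun v : EuclideanSpace ℝ (Fin 2) => v 1) ht
      simp at h0 h1
      linear_combination k * hcd - c * h0 - d * h1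

lemma Convex.chord_pos_or_neg {S : Set (EuclideanSpace ℝ (Fin 2))} (hS : Convex ℝ S) {R a b : ℝ}
    (h : ∀ s ∈ S, chord R a b s ≠ 0) :
    (∀ s ∈ S, 0 < chord R a b s) ∨ ∀ s ∈ S, chord R a b s < 0 := by
  by_contra! hcon
  obtain ⟨⟨x, hx, hx0⟩, y, hy, hy0⟩ := hcon
  obtain ⟨z, hz, hz0⟩ := hS.isPreconnected.intermediate_value hx hy
    (continuous_chord R a b).continuousOn ⟨hx0, hy0⟩
  exact h z hz hz0

lemma Convex.nonempty_inter_of_collinear {S T U : Set (EuclideanSpace ℝ (Fin 2))}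
    (hS : Convex ℝ S) (hT : Convex ℝ T) (hU : Convex ℝ U) {p q r : EuclideanSpace ℝ (Fin 2)}
    (hp : p ∈ S ∩ T) (hq : q ∈ S ∩ U) (hr : r ∈ T ∩ U) (h : Collinear ℝ {p, q, r}) :
    (S ∩ T ∩ U).Nonempty := by
  rcases h.wbtw_or_wbtw_or_wbtw with h | h | h
  · exact ⟨q, ⟨hq.1, hT.segment_subset hp.2 hr.1 h.mem_segment⟩, hq.2⟩
  · exact ⟨r, ⟨hS.segment_subset hq.1 hp.1 h.mem_segment, hr.1⟩, hr.2⟩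
  · exact ⟨p, hp, hU.segment_subset hr.2 hq.2 h.mem_segment⟩

lemma IsLine.collinear {l : Set (EuclideanSpace ℝ (Fin 2))} (hl : IsLine l)
    {p q r : EuclideanSpace ℝ (Fin 2)} (hp : p ∈ l) (hq : q ∈ l) (hr : r ∈ l) :
    Collinear ℝ {p, q, r} := by
  obtain ⟨L, hL, rfl⟩ := hl
  rw [collinear_iff_finrank_le_one, ← hL]
  refine Submodule.finrank_mono ?_
  rw [← direction_affineSpan]
  refine AffineSubspace.direction_le (affineSpan_le.2 ?_)
  rintro x (rfl | rfl | rfl) <;> assumption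

/-- The two triangular regions on opposite sides of all three lines are not both nonempty. -/
lemma not_chord_opposite {R a₀ b₀ a₁ b₁ a₂ b₂ : ℝ} (h₀₁ : a₀ + b₀ < a₁ + b₁)
    (h₁₂ : a₁ + b₁ < a₂ + b₂) (h₀₂ : a₂ + b₂ - (a₀ + b₀) < Real.pi)
    {z z' : EuclideanSpace ℝ (Fin 2)}
    (hz : 0 < chord R a₀ b₀ z ∧ chord R a₁ b₁ z < 0 ∧ 0 < chord R a₂ b₂ z)
    (hz' : chord R a₀ b₀ z' < 0 ∧ 0 < chord R a₁ b₁ z' ∧ chord R a₂ b₂ z' < 0) : False := by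
  have p₀ := Real.sin_pos_of_pos_of_lt_pi (x := a₂ + b₂ - (a₁ + b₁)) (by linarith) (by linarith)
  have p₁ := Real.sin_pos_of_pos_of_lt_pi (x := a₂ + b₂ - (a₀ + b₀)) (by linarith) (by linarith)
  have p₂ := Real.sin_pos_of_pos_of_lt_pi (x := a₁ + b₁ - (a₀ + b₀)) (by linarith) (by linarith)
  have key : Real.sin (a₂ + b₂ - (a₁ + b₁)) * (chord R a₀ b₀ z - chord R a₀ b₀ z')
      - Real.sin (a₂ + b₂ - (a₀ + b₀)) * (chord R a₁ b₁ z - chord R a₁ b₁ z')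
      + Real.sin (a₁ + b₁ - (a₀ + b₀)) * (chord R a₂ b₂ z - chord R a₂ b₂ z') = 0 := by
    unfold chord
    rw [Real.sin_sub (a₂ + b₂), Real.sin_sub (a₂ + b₂), Real.sin_sub (a₁ + b₁)]
    ring
  have q₀ := mul_pos p₀ (sub_pos.2 (hz'.1.trans hz.1))
  have q₁ := mul_pos p₁ (sub_pos.2 (hz.2.1.trans hz'.2.1))
  have q₂ := mul_pos p₂ (sub_pos.2 (hz'.2.2.trans hz.2.2))
  linarith

/-- Half of the angle of the `k`-th of the points dividing a circle into arcs of lengths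
proportional to `y 0, …, y 5`. -/
noncomputable def halfAngle (y : Fin 6 → ℝ) (k : ℕ) : ℝ :=
  Real.pi * ∑ j ∈ Finset.range k, y (Fin.ofNat 6 j)

/-- The chord joining the `k`-th and `(k + 3)`-th of the six points dividing the circle of radius `R`
into arcs of lengths proportional to `y 0, …, y 5`. -/
noncomputable def mainChord (R : ℝ) (k : ℕ) (y : Fin 6 → ℝ) (s : EuclideanSpace ℝ (Fin 2)) : ℝ :=
  chord R (halfAngle y k) (halfAngle y (k + 3)) s

/-- A function whose positivity set is the union of the faces of the arrangement of the three main
chords that abut the `i`-th arc. -/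
noncomputable def region (R : ℝ) (i : Fin 6) (y : Fin 6 → ℝ) (s : EuclideanSpace ℝ (Fin 2)) : ℝ :=
  ![min (mainChord R 0 y s) (-mainChord R 1 y s), min (mainChord R 1 y s) (-mainChord R 2 y s),
    min (mainChord R 2 y s) (mainChord R 0 y s), min (-mainChord R 0 y s) (mainChord R 1 y s),
    min (-mainChord R 1 y s) (mainChord R 2 y s), min (-mainChord R 2 y s) (-mainChord R 0 y s)] i

lemma continuous_mainChord (R : ℝ) (k : ℕ) :
    Continuous fun p : (Fin 6 → ℝ) × EuclideanSpace ℝ (Fin 2) => mainChord R k p.1 p.2 := by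
  unfold mainChord chord halfAngle
  fun_prop

lemma continuous_region (R : ℝ) (i : Fin 6) :
    Continuous fun p : (Fin 6 → ℝ) × EuclideanSpace ℝ (Fin 2) => region R i p.1 p.2 := by
  have h := continuous_mainChord R
  fin_cases i
  · exact (h 0).min (h 1).neg
  · exact (h 1).min (h 2).neg
  · exact (h 2).min (h 0)
  · exact (h 0).neg.min (h 1)
  · exact (h 1).neg.min (h 2)
  · exact (h 2).neg.min (h 0).neg

lemma halfAngle_succ (y : Fin 6 → ℝ) (k : ℕ) :
    halfAngle y (k + 1) = halfAngle y k + Real.pi * y (Fin.ofNat 6 k) := by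
  rw [halfAngle, Finset.sum_range_succ, mul_add, halfAngle]

lemma halfAngle_mono {y : Fin 6 → ℝ} (hy : ∀ i, 0 ≤ y i) : Monotone (halfAngle y) :=
  monotone_nat_of_le_succ fun k => by
    rw [halfAngle_succ]
    exact le_add_of_nonneg_right (mul_nonneg Real.pi_pos.le (hy _))

lemma halfAngle_zero (y : Fin 6 → ℝ) : halfAngle y 0 = 0 := by
  simp [halfAngle]

lemma halfAngle_six {y : Fin 6 → ℝ} (hy : y ∈ stdSimplex ℝ (Fin 6)) :
    halfAngle y 6 = Real.pi := by
  rw [halfAngle, Finset.sum_range fun j => y (Fin.ofNat 6 j)]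
  simp [hy.2]

/-- A face abutting an arc of length zero is disjoint from the open disc. -/
lemma region_nonpos {R : ℝ} {i : Fin 6} {y : Fin 6 → ℝ} {s : EuclideanSpace ℝ (Fin 2)}
    (hy : y ∈ stdSimplex ℝ (Fin 6)) (hi : y i = 0) (hs : ‖s‖ < R) : ¬ 0 < region R i y s := by
  have hm := halfAngle_mono hy.1
  have h01 := hm (show 0 ≤ 1 by lia)
  have h12 := hm (show 1 ≤ 2 by lia)
  have h23 := hm (show 2 ≤ 3 by lia)
  have h34 := hm (show 3 ≤ 4 by lia)
  have h45 := hm (show 4 ≤ 5 by lia)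
  have h56 := hm (show 5 ≤ 6 by lia)
  have h0 := halfAngle_zero y
  have h6 := halfAngle_six hy
  have hstep : halfAngle y (i + 1) = halfAngle y i := by
    rw [halfAngle_succ, Fin.ofNat_val_eq_self, hi, mul_zero, add_zero]
  have hn : ∀ k, -mainChord R k y s =
      chord R (halfAngle y (k + 3)) (halfAngle y k + Real.pi) s := fun k =>
    (chord_add_pi R _ _ s).symm
  fin_cases i
  · intro h
    obtain ⟨h1, h2⟩ := lt_min_iff.1 h
    refine (neg_pos.1 h2).not_gt ?_
    simp only [mainChord] at h1 hstep ⊢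
    norm_num at h1 hstep ⊢
    rw [hstep]
    exact chord_pos_of_le hs (by linarith) h34 (by linarith) h1
  · intro h
    obtain ⟨h1, h2⟩ := lt_min_iff.1 h
    refine (neg_pos.1 h2).not_gt ?_
    simp only [mainChord] at h1 hstep ⊢
    norm_num at h1 hstep ⊢
    rw [hstep]
    exact chord_pos_of_le hs (by linarith) h45 (by linarith) h1
  · intro h
    obtain ⟨h1, h2⟩ := lt_min_iff.1 h
    refine h2.not_gt (neg_pos.1 ?_)
    rw [hn]
    simp only [mainChord] at h1 hstep ⊢
    norm_num at h1 hstep ⊢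
    rw [hstep]
    exact chord_pos_of_le hs (by linarith) (by linarith) (by linarith) h1
  · intro h
    obtain ⟨h1, h2⟩ := lt_min_iff.1 h
    refine h2.not_gt (neg_pos.1 ?_)
    rw [hn] at h1 ⊢
    norm_num at h1 hstep ⊢
    rw [hstep]
    exact chord_pos_of_le hs (by linarith) (by linarith) (by linarith) h1
  · intro h
    obtain ⟨h1, h2⟩ := lt_min_iff.1 h
    refine h2.not_gt (neg_pos.1 ?_)
    rw [hn] at h1 ⊢
    norm_num at h1 hstep ⊢
    rw [hstep]
    exact chord_pos_of_le hs (by linarith) (by linarith) (by linarith) h1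
  · intro h
    obtain ⟨h1, h2⟩ := lt_min_iff.1 h
    refine (neg_pos.1 h2).not_gt ?_
    rw [hn] at h1
    simp only [mainChord]
    norm_num at h1 hstep ⊢
    have h5 : halfAngle y 5 = 0 + Real.pi := by rw [← hstep, h6, zero_add]
    rw [h0, ← neg_neg (chord R 0 (halfAngle y 3) s), ← chord_add_pi, ← chord_add_pi, ← h5]
    exact chord_pos_of_le hs (by linarith) (by linarith) (by linarith) h1

/-- A convex set that misses the three main chords lies in a face abutting some arc. -/
lemma Convex.exists_region_pos {S : Set (EuclideanSpace ℝ (Fin 2))} (hS : Convex ℝ S) {R : ℝ}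
    {y : Fin 6 → ℝ} (h : ∀ k < 3, ∀ s ∈ S, mainChord R k y s ≠ 0) :
    ∃ i, ∀ s ∈ S, 0 < region R i y s := by
  have h' : ∀ k < 3, (∀ s ∈ S, 0 < mainChord R k y s) ∨ ∀ s ∈ S, mainChord R k y s < 0 :=
    fun k hk => hS.chord_pos_or_neg (h k hk)
  rcases h' 0 (by lia) with h0 | h0
  · rcases h' 1 (by lia) with h1 | h1
    · rcases h' 2 (by lia) with h2 | h2
      · exact ⟨2, fun s hs => lt_min (h2 s hs) (h0 s hs)⟩
      · exact ⟨1, fun s hs => lt_min (h1 s hs) (neg_pos.2 (h2 s hs))⟩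
    · exact ⟨0, fun s hs => lt_min (h0 s hs) (neg_pos.2 (h1 s hs))⟩
  · rcases h' 1 (by lia) with h1 | h1
    · exact ⟨3, fun s hs => lt_min (neg_pos.2 (h0 s hs)) (h1 s hs)⟩
    · rcases h' 2 (by lia) with h2 | h2
      · exact ⟨4, fun s hs => lt_min (neg_pos.2 (h1 s hs)) (h2 s hs)⟩
      · exact ⟨5, fun s hs => lt_min (neg_pos.2 (h2 s hs)) (neg_pos.2 (h0 s hs))⟩

/-- How deep `S` lies in the faces abutting the `i`-th arc (zero if it is not contained in them). -/
noncomputable def depth (R : ℝ) (S : Set (EuclideanSpace ℝ (Fin 2))) (i : Fin 6)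
    (y : Fin 6 → ℝ) : ℝ :=
  max 0 (sInf (region R i y '' S))

lemma IsCompact.continuous_depth {S : Set (EuclideanSpace ℝ (Fin 2))} (hS : IsCompact S) (R : ℝ)
    (i : Fin 6) : Continuous (depth R S i) :=
  continuous_const.max (hS.continuous_sInf (f := region R i) (continuous_region R i))

lemma nonempty_of_depth_pos {R : ℝ} {S : Set (EuclideanSpace ℝ (Fin 2))} {i : Fin 6}
    {y : Fin 6 → ℝ} (h : 0 < depth R S i y) : S.Nonempty := by
  by_contra hS
  rw [Set.not_nonempty_iff_eq_empty.1 hS] at h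
  simp [depth] at h

lemma IsCompact.depth_pos_iff {S : Set (EuclideanSpace ℝ (Fin 2))} (hS : IsCompact S)
    (hne : S.Nonempty) {R : ℝ} {i : Fin 6} {y : Fin 6 → ℝ} :
    0 < depth R S i y ↔ ∀ s ∈ S, 0 < region R i y s := by
  have hc : Continuous (region R i y) := (continuous_region R i).comp (.prodMk_right y)
  rw [depth, lt_max_iff, or_iff_right (lt_irrefl _),
    hS.lt_sInf_iff_of_continuous hne hc.continuousOn]

lemma mrank_eq_card {α : Type*} {M : Matroid α} {G : Finset α} (hG : M.Indep ↑G) :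
    mrank M ↑G = G.card := by
  refine IsGreatest.csSup_eq ⟨⟨G, subset_rfl, hG, Set.ncard_coe_finset G⟩, ?_⟩
  rintro n ⟨I, hI, -, rfl⟩
  exact (Set.ncard_le_ncard hI).trans_eq (Set.ncard_coe_finset G)

lemma exists_indep_range_of_le_mrank {α : Type*} {M : Matroid α} {A : Set α} (hA : A.Finite)
    {n : ℕ} (hn : n ≤ mrank M A) :
    ∃ b : Fin n → α, Function.Injective b ∧ M.Indep (Set.range b) ∧ ∀ k, b k ∈ A := by
  obtain ⟨I, hIA, hI, hc⟩ := Nat.sSup_mem (s := {n : ℕ | ∃ I ⊆ A, M.Indep I ∧ I.ncard = n})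
    ⟨0, ∅, A.empty_subset, M.empty_indep, Set.ncard_empty α⟩
    ⟨A.ncard, by rintro n ⟨I, hI, -, rfl⟩; exact Set.ncard_le_ncard hI hA⟩
  obtain ⟨T, hTI, hT⟩ := Set.exists_subset_card_eq (s := I) (n := n) (hn.trans_eq hc.symm)
  have hfin : T.Finite := hA.subset (hTI.trans hIA)
  have : Finite T := hfin
  let e := (Finite.equivFinOfCardEq (α := T) hT).symm
  refine ⟨fun k => e k, Subtype.val_injective.comp e.injective, hI.subset ?_, fun k =>
    hIA (hTI (e k).2)⟩
  rintro _ ⟨k, rfl⟩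
  exact hTI (e k).2

/-- If no arc has length zero and each `p i` lies in a face abutting the `i`-th arc, then the points
of even index or those of odd index are not collinear. -/
lemma not_isLine_transversals {R : ℝ} {y : Fin 6 → ℝ} (hy : y ∈ stdSimplex ℝ (Fin 6))
    (hpos : ∀ i, 0 < y i) {l l' : Set (EuclideanSpace ℝ (Fin 2))} (hl : IsLine l)
    (hl' : IsLine l') {p : Fin 6 → EuclideanSpace ℝ (Fin 2)} (hp : ∀ i, 0 < region R i y (p i))
    (h0 : p 0 ∈ l) (h2 : p 2 ∈ l) (h4 : p 4 ∈ l) (h1 : p 1 ∈ l') (h3 : p 3 ∈ l')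
    (h5 : p 5 ∈ l') : False := by
  have p0 := lt_min_iff.1 (hp 0)
  have p1 := lt_min_iff.1 (hp 1)
  have p2 := lt_min_iff.1 (hp 2)
  have p3 := lt_min_iff.1 (hp 3)
  have p4 := lt_min_iff.1 (hp 4)
  have p5 := lt_min_iff.1 (hp 5)
  simp only [neg_pos] at p0 p1 p2 p3 p4 p5
  obtain ⟨z, ⟨z0, z1⟩, z2⟩ := Convex.nonempty_inter_of_collinear
    (S := {s | 0 < mainChord R 0 y s}) (T := {s | mainChord R 1 y s < 0})
    (U := {s | 0 < mainChord R 2 y s}) (convex_chord_pos _ _ _) (convex_chord_neg _ _ _)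
    (convex_chord_pos _ _ _) p0 p2.symm p4 (hl.collinear h0 h2 h4)
  obtain ⟨z', ⟨hz0, hz1⟩, hz2⟩ := Convex.nonempty_inter_of_collinear
    (S := {s | mainChord R 0 y s < 0}) (T := {s | 0 < mainChord R 1 y s})
    (U := {s | mainChord R 2 y s < 0}) (convex_chord_neg _ _ _) (convex_chord_pos _ _ _)
    (convex_chord_neg _ _ _) p3 p5.symm p1 (hl'.collinear h3 h5 h1)
  have hlt : StrictMono (halfAngle y) := strictMono_nat_of_lt_succ fun k => by
    rw [halfAngle_succ]
    exact lt_add_of_pos_right _ (mul_pos Real.pi_pos (hpos _))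
  have h01 := hlt (show 0 < 1 by lia)
  have h12 := hlt (show 1 < 2 by lia)
  have h23 := hlt (show 2 < 3 by lia)
  have h34 := hlt (show 3 < 4 by lia)
  have h45 := hlt (show 4 < 5 by lia)
  have h56 := hlt (show 5 < 6 by lia)
  have h0' := halfAngle_zero y
  have h6 := halfAngle_six hy
  exact not_chord_opposite (by norm_num; linarith) (by norm_num; linarith)
    (by norm_num; linarith) ⟨z0, z1, z2⟩ ⟨hz0, hz1, hz2⟩

/-- **Matroid coloring version of the `T(3)` theorem.** Let `F` be a finite family
of compact convex sets in `ℝ²` and `M` a matroid with ground set `F` and rank 6.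
If every 3 sets of `F` of rank 3 can be pierced by a line, then there are 3 lines
piercing a subfamily `F' ⊆ F` with `r(F ∖ F') ≤ 5`. -/
theorem matroid_T3 (F : Finset (Set (EuclideanSpace ℝ (Fin 2))))
    (hcompact : ∀ s ∈ F, IsCompact s) (hconvex : ∀ s ∈ F, Convex ℝ s)
    (M : Matroid (Set (EuclideanSpace ℝ (Fin 2)))) (hE : M.E = ↑F)
    (hrk : mrank M ↑F = 6)
    (hT3 : ∀ G ⊆ F, G.card = 3 → mrank M ↑G = 3 →
      ∃ l, IsLine l ∧ ∀ s ∈ G, (l ∩ s).Nonempty) :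
    ∃ F' ⊆ F, mrank M ((F : Set (Set (EuclideanSpace ℝ (Fin 2)))) \ ↑F') ≤ 5 ∧
      ∃ l₁ l₂ l₃, IsLine l₁ ∧ IsLine l₂ ∧ IsLine l₃ ∧
        ∀ s ∈ F', ((l₁ ∪ l₂ ∪ l₃) ∩ s).Nonempty := by
  classical
  by_contra! hcon
  have hT3' : ∀ f : Fin 6 → Set (EuclideanSpace ℝ (Fin 2)), (∀ i, f i ∈ F) →
      Function.Injective f → M.Indep (Set.range f) → ∀ t : Finset (Fin 6), t.card = 3 →
      ∃ l, IsLine l ∧ ∀ i ∈ t, (l ∩ f i).Nonempty := by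
    intro f hF hf hi t ht
    have hc : (t.image f).card = 3 := by rw [Finset.card_image_of_injective _ hf, ht]
    obtain ⟨l, hl, h⟩ := hT3 (t.image f) (Finset.image_subset_iff.2 fun i _ => hF i) hc
      (by rw [mrank_eq_card (hi.subset (by simp)), hc])
    exact ⟨l, hl, fun i hit => h _ (Finset.mem_image_of_mem f hit)⟩
  obtain ⟨R, hR⟩ : ∃ R, ∀ S ∈ F, ∀ s ∈ S, ‖s‖ < R := by
    obtain ⟨R, hR⟩ := (F.isCompact_biUnion (f := id) hcompact).isBounded.exists_norm_le
    exact ⟨R + 1, fun S hS s hs => lt_add_of_le_of_pos (hR s (Set.mem_biUnion hS hs)) one_pos⟩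
  have hdepth : ∀ y ∈ stdSimplex ℝ (Fin 6), ∀ S ∈ F, ∀ i, 0 < depth R S i y → y i ≠ 0 := by
    intro y hy S hS i hd hyi
    obtain ⟨s, hs⟩ := nonempty_of_depth_pos hd
    exact region_nonpos hy hyi (hR S hS s hs)
      (((hcompact S hS).depth_pos_iff ⟨s, hs⟩).1 hd s hs)
  have hcover : ∀ y, ∃ b : Fin 6 → F, ∃ lab : Fin 6 → Fin 6,
      (Function.Injective b ∧ M.Indep (Set.range fun k => (b k : Set _))) ∧
        ∀ k, 0 < depth R (b k) (lab k) y := by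
    intro y
    obtain ⟨F', hF'⟩ : ∃ F' : Finset (Set (EuclideanSpace ℝ (Fin 2))),
        ∀ S, S ∈ F' ↔ S ∈ F ∧ ∃ k < 3, ∃ s ∈ S, mainChord R k y s = 0 :=
      ⟨F.filter _, fun _ => Finset.mem_filter⟩
    have hrank : 6 ≤ mrank M ((F : Set (Set (EuclideanSpace ℝ (Fin 2)))) \ ↑F') := by
      by_contra! hlt
      obtain ⟨S, hS, hne⟩ := hcon F' (fun S hS => ((hF' S).1 hS).1) (Nat.le_of_lt_succ hlt)
        {s | mainChord R 0 y s = 0}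
        {s | mainChord R 1 y s = 0} {s | mainChord R 2 y s = 0} (isLine_chord _ _ _)
        (isLine_chord _ _ _) (isLine_chord _ _ _)
      obtain ⟨-, k, hk, s, hs, h0⟩ := (hF' S).1 hS
      refine Set.eq_empty_iff_forall_notMem.1 hne s ⟨?_, hs⟩
      interval_cases k
      · exact Or.inl (Or.inl h0)
      · exact Or.inl (Or.inr h0)
      · exact Or.inr h0
    obtain ⟨b, hb, hi, hmem⟩ := exists_indep_range_of_le_mrank (F.finite_toSet.sdiff) hrank
    have hbF : ∀ k, b k ∈ F := fun k => (hmem k).1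
    have hne : ∀ k, (b k).Nonempty := by
      intro k
      obtain ⟨t, hkt, ht⟩ := Finset.exists_superset_card_eq (s := {k}) (n := 3) (by simp) (by simp)
      obtain ⟨l, -, hl⟩ := hT3' b hbF hb hi t ht
      exact (hl k (hkt (Finset.mem_singleton_self k))).right
    have hlab : ∀ k, ∃ i, 0 < depth R (b k) i y := by
      intro k
      obtain ⟨i, hreg⟩ := (hconvex _ (hbF k)).exists_region_pos (R := R) (y := y)
        fun j hj s hs h0 => (hmem k).2 ((hF' _).2 ⟨hbF k, j, hj, s, hs, h0⟩)
      exact ⟨i, ((hcompact _ (hbF k)).depth_pos_iff (hne k)).2 hreg⟩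
    choose lab hlab using hlab
    exact ⟨fun k => ⟨b k, hbF k⟩, lab, ⟨fun _ _ h => hb (congrArg Subtype.val h), hi⟩, hlab⟩
  let w : (Fin 6 → F) × (Fin 6 → Fin 6) → (Fin 6 → ℝ) → ℝ := fun j y =>
    if Function.Injective j.1 ∧ M.Indep (Set.range fun k => (j.1 k : Set _)) then
      ∏ k, depth R (j.1 k) (j.2 k) y else 0
  have hd0 : ∀ S i y, 0 ≤ depth R S i y := fun S i y => le_max_left _ _
  have hw : ∀ j y, 0 < w j y →
      (Function.Injective j.1 ∧ M.Indep (Set.range fun k => (j.1 k : Set _))) ∧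
        ∀ k, 0 < depth R (j.1 k) (j.2 k) y := by
    intro j y h
    by_cases hj : Function.Injective j.1 ∧ M.Indep (Set.range fun k => (j.1 k : Set _))
    · refine ⟨hj, fun k => (hd0 _ _ _).lt_of_ne' fun h0 => ?_⟩
      simp only [w, if_pos hj] at h
      exact h.ne' (Finset.prod_eq_zero (Finset.mem_univ k) h0)
    · simp only [w, if_neg hj, lt_irrefl] at h
  obtain ⟨y, hy, hbal⟩ := exists_balanced_labelling (I := Fin 6) (κ := Fin 6) (by simp) rfl w
    (fun j => by
      by_cases hj : Function.Injective j.1 ∧ M.Indep (Set.range fun k => (j.1 k : Set _))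
      · simp only [w, if_pos hj]
        exact continuous_finsetProd _ fun k _ =>
          (hcompact _ (j.1 k).2).continuous_depth R (j.2 k)
      · simp only [w, if_neg hj]
        exact continuous_const)
    (fun j y => by
      by_cases hj : Function.Injective j.1 ∧ M.Indep (Set.range fun k => (j.1 k : Set _))
      · simp only [w, if_pos hj]
        exact Finset.prod_nonneg fun k _ => hd0 _ _ _
      · simp only [w, if_neg hj, le_refl])
    (fun y _ => by
      obtain ⟨b, lab, hb, hd⟩ := hcover y
      refine ⟨(b, lab), ?_⟩
      simp only [w, if_pos hb]
      exact Finset.prod_pos fun k _ => hd k)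
    (fun j => j.2) (fun y hy j h k => hdepth y hy _ (j.1 k).2 _ ((hw j y h).2 k))
  obtain ⟨f, hf, hfi, hfN⟩ := M.exists_indep_transversal
    (fun i => F.filter fun S => 0 < depth R S i y) (by
      intro S
      obtain ⟨j, hj, hS⟩ := hbal S
      obtain ⟨⟨hinj, hind⟩, hd⟩ := hw j y hj
      have hinj' : Function.Injective fun k => (j.1 k : Set (EuclideanSpace ℝ (Fin 2))) :=
        Subtype.val_injective.comp hinj
      set T := (Finset.univ.filter fun k => j.2 k ∈ S).image
        fun k => (j.1 k : Set (EuclideanSpace ℝ (Fin 2))) with hT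
      have hTi : M.Indep (T : Set (Set (EuclideanSpace ℝ (Fin 2)))) :=
        hind.subset (by rw [hT, Finset.coe_image]; exact Set.image_subset_range _ _)
      have hTs : (T : Set (Set (EuclideanSpace ℝ (Fin 2)))) ⊆
          ↑(S.biUnion fun i => F.filter fun U => 0 < depth R U i y) := by
        refine Finset.coe_subset.2 (Finset.image_subset_iff.2 fun k hk => ?_)
        exact Finset.mem_biUnion.2 ⟨j.2 k, (Finset.mem_filter.1 hk).2,
          Finset.mem_filter.2 ⟨(j.1 k).2, hd k⟩⟩
      refine le_trans ?_ (hTi.encard_le_eRk_of_subset hTs)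
      rw [Set.encard_coe_eq_coe_finsetCard, hT, Finset.card_image_of_injective _ hinj']
      exact_mod_cast hS)
  have hfF : ∀ i, f i ∈ F := fun i => (Finset.mem_filter.1 (hfN i)).1
  have hfd : ∀ i, 0 < depth R (f i) i y := fun i => (Finset.mem_filter.1 (hfN i)).2
  obtain ⟨l, hl, hlf⟩ := hT3' f hfF hf hfi {0, 2, 4} rfl
  obtain ⟨l', hl', hlf'⟩ := hT3' f hfF hf hfi {1, 3, 5} rfl
  have hdisj : ∀ i ∈ ({0, 2, 4} : Finset (Fin 6)), i ∉ ({1, 3, 5} : Finset (Fin 6)) := by decide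
  have hpt : ∀ i, ∃ p ∈ f i, (i ∈ ({0, 2, 4} : Finset (Fin 6)) → p ∈ l) ∧
      (i ∈ ({1, 3, 5} : Finset (Fin 6)) → p ∈ l') := by
    intro i
    by_cases hi : i ∈ ({0, 2, 4} : Finset (Fin 6))
    · obtain ⟨p, hpl, hp⟩ := hlf i hi
      exact ⟨p, hp, fun _ => hpl, fun hi' => absurd hi' (hdisj i hi)⟩
    · have hi' : i ∈ ({1, 3, 5} : Finset (Fin 6)) := by revert i; decide
      obtain ⟨p, hpl, hp⟩ := hlf' i hi'
      exact ⟨p, hp, fun h => absurd h hi, fun _ => hpl⟩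
  choose p hpf hpl hpl' using hpt
  exact not_isLine_transversals hy
    (fun i => (hy.1 i).lt_of_ne' (hdepth y hy _ (hfF i) i (hfd i))) hl hl'
    (fun i => ((hcompact _ (hfF i)).depth_pos_iff ⟨p i, hpf i⟩).1 (hfd i) _ (hpf i))
    (hpl 0 (by decide)) (hpl 2 (by decide)) (hpl 4 (by decide))
    (hpl' 1 (by decide)) (hpl' 3 (by decide)) (hpl' 5 (by decide))
end

section
/- Let P ⊆ ℝ^d be a polytope with p ∈ P, let T be a triangulation of P, and let λ : V(T) → F(P) be a Sperner–Shapley labeling of T. Suppose that for every vertex v ∈ V(T) a point y(v) ∈ λ(v) is assigned. Then there is a simplex τ of T such that p ∈ conv{y(v) : v ∈ V(τ)}. -/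
variable {N : ℕ}

/-- `P` is a polytope: the convex hull of a finite set of points. -/
def IsPolytope (P : Set (EuclideanSpace ℝ (Fin N))) : Prop :=
  ∃ S : Finset (EuclideanSpace ℝ (Fin N)), P = convexHull ℝ ↑S

/-- `F(P)`: the set of nonempty faces of `P`, a face being `P` itself or a
nonempty exposed face of `P`. -/
def polyFaces (P : Set (EuclideanSpace ℝ (Fin N))) :
    Set (Set (EuclideanSpace ℝ (Fin N))) :=
  {σ | σ.Nonempty ∧ (σ = P ∨ IsExposed ℝ P σ)}

/-- `supp(v)`: the minimal face of `P` containing `v`, i.e. the intersection of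
all faces of `P` containing `v`. -/
def suppFace (P : Set (EuclideanSpace ℝ (Fin N))) (v : EuclideanSpace ℝ (Fin N)) :
    Set (EuclideanSpace ℝ (Fin N)) :=
  ⋂₀ {σ | σ ∈ polyFaces P ∧ v ∈ σ}

/-- `T` is a triangulation of `P`: a finite simplicial complex whose underlying
space is `P`. -/
def IsTriangulation (T : Geometry.SimplicialComplex ℝ (EuclideanSpace ℝ (Fin N)))
    (P : Set (EuclideanSpace ℝ (Fin N))) : Prop :=
  T.faces.Finite ∧ T.space = P

/-- `S` is dominant for a family of rankings `r` if no point is ranked strictly above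
the minimum of `S` in every one of the rankings. -/
def IsDominant {I Z : Type*} (r : I → Z → ℕ) (S : Finset Z) : Prop :=
  ∀ y, ∃ i, ∀ x ∈ S, r i y ≤ r i x

section Dominant

variable {I Z : Type*} {r : I → Z → ℕ}

theorem IsDominant.mono {S T : Finset Z} (hS : IsDominant r S) (h : T ⊆ S) :
    IsDominant r T := fun y => (hS y).imp fun _ hi x hx => hi x (h hx)

variable [Fintype I] [DecidableEq Z]

/-- A point extending `T` to a dominant set of full cardinality becomes the minimum of exactly one
ranking, and is maximal among the points lying above the minima of `T` in all the others. -/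
theorem IsDominant.exists_index_of_insert (hr : ∀ i, Function.Injective (r i))
    {T : Finset Z} (hcard : T.card + 1 = Fintype.card I) {m : I → Z} (hmT : ∀ i, m i ∈ T)
    (hm : ∀ i, ∀ x ∈ T, r i (m i) ≤ r i x) {z : Z} (hz : z ∉ T)
    (hdom : IsDominant r (insert z T)) :
    ∃ k, r k z < r k (m k) ∧ (∀ i, i ≠ k → r i (m i) < r i z) ∧
      Set.InjOn m {i | i ≠ k} ∧ ∀ y, (∀ i, i ≠ k → r i (m i) < r i y) → r k y ≤ r k z := by
  classical
  have hne : ∀ i, r i z ≠ r i (m i) := fun i h => hz (hr i h ▸ hmT i)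
  obtain ⟨k, hk⟩ := hdom z
  have hkz : r k z < r k (m k) :=
    lt_of_le_of_ne (hk _ (Finset.mem_insert_of_mem (hmT k))) (hne k)
  choose g hg using fun t : T => hdom t
  have hgm : ∀ t : T, m (g t) = t := fun t => hr (g t) <| le_antisymm (hm _ _ t.2)
    (hg t _ (Finset.mem_insert_of_mem (hmT _)))
  have hgz : ∀ t : T, r (g t) (m (g t)) < r (g t) z := fun t =>
    lt_of_le_of_ne (by rw [hgm]; exact hg t z (Finset.mem_insert_self _ _)) (hne _).symm
  have hgk : ∀ t, g t ≠ k := fun t h => by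
    have h1 := hgz t
    rw [h] at h1
    exact absurd h1 hkz.not_gt
  have hginj : Function.Injective g := fun s t h => by
    apply Subtype.ext
    rw [← hgm s, ← hgm t, h]
  have himg : Finset.univ.image g = Finset.univ.erase k := by
    apply Finset.eq_of_subset_of_card_le
    · intro i hi
      obtain ⟨t, -, rfl⟩ := Finset.mem_image.1 hi
      simp [hgk t]
    · rw [Finset.card_image_of_injective _ hginj, Finset.card_erase_of_mem (Finset.mem_univ _)]
      simp [← hcard]
  have hsurj : ∀ i, i ≠ k → ∃ t, g t = i := fun i hi => by
    have : i ∈ Finset.univ.image g := by rw [himg]; simp [hi]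
    simpa using this
  have habove : ∀ i, i ≠ k → r i (m i) < r i z := fun i hi => by
    obtain ⟨t, rfl⟩ := hsurj i hi
    exact hgz t
  refine ⟨k, hkz, habove, ?_, ?_⟩
  · intro i hi j hj h
    obtain ⟨s, rfl⟩ := hsurj i hi
    obtain ⟨t, rfl⟩ := hsurj j hj
    rw [hgm, hgm] at h
    rw [Subtype.ext h]
  · intro y hy
    obtain ⟨i, hi⟩ := hdom y
    by_cases hik : i = k
    · subst hik
      exact hi z (Finset.mem_insert_self _ _)
    · exact absurd (hi _ (Finset.mem_insert_of_mem (hmT i))) (hy i hik).not_ge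

theorem IsDominant.exists_insert [Fintype Z] (hr : ∀ i, Function.Injective (r i))
    {T : Finset Z} (hT : IsDominant r T)
    {m : I → Z} (hmT : ∀ i, m i ∈ T) (hm : ∀ i, ∀ x ∈ T, r i (m i) ≤ r i x)
    {a b : I} (hab : b ≠ a) (hmab : m b = m a)
    (hY : ∃ y, ∀ i, i ≠ a → r i (m i) < r i y) :
    ∃ z, z ∉ T ∧ IsDominant r (insert z T) ∧ r a z < r a (m a) := by
  classical
  obtain ⟨z, hzY, hzmax⟩ := Finset.exists_max_image
    (Finset.univ.filter fun y => ∀ i, i ≠ a → r i (m i) < r i y) (r a)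
    (hY.imp fun y hy => by simpa using hy)
  simp only [Finset.mem_filter, Finset.mem_univ, true_and] at hzY hzmax
  obtain ⟨j, hj⟩ := hT z
  have hja : j = a := by
    by_contra h
    exact absurd (hj _ (hmT j)) (hzY j h).not_ge
  subst hja
  have hzm : z ≠ m j := fun h => by
    have h1 := hzY b hab
    rw [hmab, ← h] at h1
    exact lt_irrefl _ h1
  have hzlt : r j z < r j (m j) := lt_of_le_of_ne (hj _ (hmT j)) fun h => hzm (hr j h)
  refine ⟨z, fun h => absurd (hm j z h) hzlt.not_ge, fun y => ?_, hzlt⟩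
  by_cases hy : ∀ i, i ≠ j → r i (m i) < r i y
  · refine ⟨j, fun x hx => ?_⟩
    rcases Finset.mem_insert.1 hx with rfl | hx
    · exact hzmax y hy
    · exact (hzmax y hy).trans (hzlt.le.trans (hm j x hx))
  · push Not at hy
    obtain ⟨i, hi, hyi⟩ := hy
    refine ⟨i, fun x hx => ?_⟩
    rcases Finset.mem_insert.1 hx with rfl | hx
    · exact hyi.trans (hzY i hi).le
    · exact hyi.trans (hm i x hx)

/-- A dominant set with one element less than the number of rankings extends to exactly two
dominant sets of full cardinality, unless it is on the boundary. -/
theorem IsDominant.card_insert_eq_two [Fintype Z] (hr : ∀ i, Function.Injective (r i))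
    {T : Finset Z} (hT : IsDominant r T) (hcard : T.card + 1 = Fintype.card I)
    (hne : T.Nonempty) (hY : ∀ a, ∃ y, ∀ i, i ≠ a → ∃ x ∈ T, r i x < r i y)
    [DecidablePred fun z => z ∉ T ∧ IsDominant r (insert z T)] :
    (Finset.univ.filter fun z => z ∉ T ∧ IsDominant r (insert z T)).card = 2 := by
  choose m hmT hm using fun i => Finset.exists_min_image T (r i) hne
  obtain ⟨a, -, b, -, hab, hmab⟩ := Finset.exists_ne_map_eq_of_card_lt_of_maps_to
    (s := Finset.univ) (t := T) (f := m) (by rw [Finset.card_univ]; lia)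
    (fun i _ => hmT i)
  have hY' : ∀ a, ∃ y, ∀ i, i ≠ a → r i (m i) < r i y := fun a =>
    (hY a).imp fun y hy i hi => by
      obtain ⟨x, hx, hxy⟩ := hy i hi
      exact (hm i x hx).trans_lt hxy
  obtain ⟨u, huT, hu, hua⟩ := hT.exists_insert hr hmT hm hab.symm hmab.symm (hY' a)
  obtain ⟨v, hvT, hv, hvb⟩ := hT.exists_insert hr hmT hm hab hmab (hY' b)
  have key : ∀ w z k, w ∉ T → IsDominant r (insert w T) → r k w < r k (m k) →
      z ∉ T → IsDominant r (insert z T) → r k z < r k (m k) → z = w := by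
    intro w z k hw hwd hwk hz hzd hzk
    obtain ⟨k₁, -, h1, -, h1m⟩ := hwd.exists_index_of_insert hr hcard hmT hm hw
    obtain ⟨k₂, -, h2, -, h2m⟩ := hzd.exists_index_of_insert hr hcard hmT hm hz
    obtain rfl : k = k₁ := by
      by_contra h
      exact absurd hwk (h1 k h).not_gt
    obtain rfl : k = k₂ := by
      by_contra h
      exact absurd hzk (h2 k h).not_gt
    exact hr k (le_antisymm (h1m z h2) (h2m w h1))
  have huv : u ≠ v := by
    rintro rfl
    obtain ⟨k, -, h, -⟩ := hu.exists_index_of_insert hr hcard hmT hm huT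
    have hak : a = k := by
      by_contra h'
      exact absurd hua (h a h').not_gt
    have hbk : b = k := by
      by_contra h'
      exact absurd hvb (h b h').not_gt
    exact hab (hak.trans hbk.symm)
  rw [← Finset.card_pair huv]
  congr 1
  ext z
  simp only [Finset.mem_filter, Finset.mem_univ, true_and, Finset.mem_insert,
    Finset.mem_singleton]
  constructor
  · rintro ⟨hz, hzd⟩
    obtain ⟨k, hk, -, hinj, -⟩ := hzd.exists_index_of_insert hr hcard hmT hm hz
    by_cases hak : a = k
    · subst hak
      exact Or.inl (key u z a huT hu hua hz hzd hk)
    · by_cases hbk : b = k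
      · subst hbk
        exact Or.inr (key v z b hvT hv hvb hz hzd hk)
      · exact absurd (hinj hak hbk hmab) hab
  · rintro (rfl | rfl)
    · exact ⟨huT, hu⟩
    · exact ⟨hvT, hv⟩

/-- A set of cardinality `|I|` whose colours do not cover `I` has an even number of
facets coloured exactly by the complement of `k`. -/
theorem even_card_facets [DecidableEq I] (c : Z → I) (k : I) {S : Finset Z}
    (hS : S.card = Fintype.card I) (hc : S.image c ≠ Finset.univ) :
    Even (S.filter fun x => (S.erase x).image c = Finset.univ.erase k).card := by
  rcases (S.filter fun x => (S.erase x).image c = Finset.univ.erase k).eq_empty_or_nonempty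
    with h | ⟨x, hx⟩
  · simp [h]
  obtain ⟨hxS, hx⟩ := Finset.mem_filter.1 hx
  have hcardE : ∀ z ∈ S, (S.erase z).card = (Finset.univ.erase k).card := fun z hz => by
    rw [Finset.card_erase_of_mem hz, Finset.card_erase_of_mem (Finset.mem_univ k), hS,
      Finset.card_univ]
  have hinj : ∀ z ∈ S, (S.erase z).image c = Finset.univ.erase k →
      Set.InjOn c (S.erase z : Finset Z) := fun z hz h =>
    Finset.injOn_of_card_image_eq (by rw [h, hcardE z hz])
  have himg : S.image c = insert (c x) (Finset.univ.erase k) := by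
    rw [← hx, ← Finset.image_insert, Finset.insert_erase hxS]
  have hxk : c x ≠ k := fun h => hc (by
    rw [himg, h, Finset.insert_erase (Finset.mem_univ k)])
  obtain ⟨x', hx', hcx⟩ : ∃ x' ∈ S.erase x, c x' = c x := by
    rw [← Finset.mem_image, hx]
    simp [hxk]
  obtain ⟨hne, hx'S⟩ := Finset.mem_erase.1 hx'
  have : (S.filter fun x => (S.erase x).image c = Finset.univ.erase k) = {x, x'} := by
    ext z
    simp only [Finset.mem_filter, Finset.mem_insert, Finset.mem_singleton]
    constructor
    · rintro ⟨hzS, hz⟩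
      by_contra! hzz
      exact hne (hinj z hzS hz (by simp [hzz.2.symm, hx'S]) (by simp [hzz.1.symm, hxS]) hcx)
    · rintro (rfl | rfl)
      · exact ⟨hxS, hx⟩
      · refine ⟨hx'S, ?_⟩
        rw [← hx]
        ext i
        simp only [Finset.mem_image, Finset.mem_erase]
        constructor
        · rintro ⟨w, ⟨-, hw⟩, rfl⟩
          by_cases hwx : w = x
          · exact ⟨z, ⟨hne, hx'S⟩, by rw [hwx, hcx]⟩
          · exact ⟨w, ⟨hwx, hw⟩, rfl⟩
        · rintro ⟨w, ⟨-, hw⟩, rfl⟩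
          by_cases hwx : w = z
          · exact ⟨x, ⟨hne.symm, hxS⟩, by rw [hwx, hcx]⟩
          · exact ⟨w, ⟨hwx, hw⟩, rfl⟩
  rw [this, Finset.card_pair hne.symm]
  exact even_two

/-- Scarf's parity argument. -/
theorem exists_isDominant_image_eq_univ [Fintype Z] [DecidableEq I] (c : Z → I) (k : I)
    {T₀ : Finset Z} (hcard₀ : T₀.card + 1 = Fintype.card I)
    (hc₀ : T₀.image c = Finset.univ.erase k)
    (huniq : ∃! z, z ∉ T₀ ∧ IsDominant r (insert z T₀))
    (hr : ∀ i, Function.Injective (r i))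
    (hT : ∀ T : Finset Z, T ≠ T₀ → T.card + 1 = Fintype.card I →
      T.image c = Finset.univ.erase k → IsDominant r T →
      T.Nonempty ∧ ∀ a, ∃ y, ∀ i, i ≠ a → ∃ x ∈ T, r i x < r i y) :
    ∃ S : Finset Z, S.card = Fintype.card I ∧ IsDominant r S ∧ S.image c = Finset.univ := by
  classical
  by_contra! hcon
  set rooms : Finset (Finset Z) :=
    Finset.univ.filter fun S => S.card = Fintype.card I ∧ IsDominant r S
  set doors : Finset (Finset Z) := Finset.univ.filter fun T =>
    T.card + 1 = Fintype.card I ∧ T.image c = Finset.univ.erase k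
  have hcount : ∑ S ∈ rooms, (S.filter fun x => (S.erase x).image c = Finset.univ.erase k).card
      = ∑ T ∈ doors,
        (Finset.univ.filter fun z => z ∉ T ∧ IsDominant r (insert z T)).card := by
    rw [← Finset.card_sigma, ← Finset.card_sigma]
    refine Finset.card_bij' (fun p _ => ⟨p.1.erase p.2, p.2⟩)
      (fun p _ => ⟨insert p.2 p.1, p.2⟩) ?_ ?_ ?_ ?_
    · rintro ⟨S, x⟩ h
      simp only [rooms, doors, Finset.mem_sigma, Finset.mem_filter, Finset.mem_univ,
        true_and] at h ⊢
      obtain ⟨⟨h1, h2⟩, h3, h4⟩ := h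
      refine ⟨⟨by rw [Finset.card_erase_add_one h3, h1], h4⟩, by simp, ?_⟩
      rwa [Finset.insert_erase h3]
    · rintro ⟨S, x⟩ h
      simp only [rooms, doors, Finset.mem_sigma, Finset.mem_filter, Finset.mem_univ,
        true_and] at h ⊢
      obtain ⟨⟨h1, h2⟩, h3, h4⟩ := h
      refine ⟨⟨by rw [Finset.card_insert_of_notMem h3, h1], h4⟩, by simp, ?_⟩
      rwa [Finset.erase_insert h3]
    · rintro ⟨S, x⟩ h
      simp only [Finset.mem_sigma, Finset.mem_filter] at h
      simp [Finset.insert_erase h.2.1]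
    · rintro ⟨S, x⟩ h
      simp only [Finset.mem_sigma, Finset.mem_filter] at h
      simp [Finset.erase_insert h.2.2.1]
  have heven : Even (∑ S ∈ rooms,
      (S.filter fun x => (S.erase x).image c = Finset.univ.erase k).card) := by
    refine Finset.even_sum _ fun S hS => ?_
    simp only [rooms, Finset.mem_filter, Finset.mem_univ, true_and] at hS
    exact even_card_facets c k hS.1 (hcon S hS.1 hS.2)
  have hmem : T₀ ∈ doors := by simp [doors, hcard₀, hc₀]
  have hone : (Finset.univ.filter fun z => z ∉ T₀ ∧ IsDominant r (insert z T₀)).card = 1 := by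
    obtain ⟨z, hz, hz'⟩ := huniq
    refine Finset.card_eq_one.2 ⟨z, ?_⟩
    ext w
    simp only [Finset.mem_filter, Finset.mem_univ, true_and, Finset.mem_singleton]
    exact ⟨hz' w, fun h => h ▸ hz⟩
  have heven' : Even (∑ T ∈ doors.erase T₀,
      (Finset.univ.filter fun z => z ∉ T ∧ IsDominant r (insert z T)).card) := by
    refine Finset.even_sum _ fun T hTd => ?_
    simp only [doors, Finset.mem_erase, Finset.mem_filter, Finset.mem_univ, true_and] at hTd
    by_cases hdom : IsDominant r T
    · obtain ⟨h1, h2⟩ := hT T hTd.1 hTd.2.1 hTd.2.2 hdom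
      rw [hdom.card_insert_eq_two hr hTd.2.1 h1 h2]
      exact even_two
    · rw [Finset.filter_false_of_mem]
      · simp
      · rintro z - ⟨-, h⟩
        exact hdom (h.mono (Finset.subset_insert z T))
  rw [hcount, ← Finset.add_sum_erase _ _ hmem, hone, Nat.even_add] at heven
  simp [heven'] at heven

end Dominant

/-- A form of Scarf's lemma: if the points of a finite set are scored by finitely many criteria and
each of them is coloured by a criterion, then some set `σ` of points is such that no point beats all
of `σ` in every criterion occurring as a colour in `σ`. -/
theorem exists_undominated_finset {I X : Type*} [Fintype I] [DecidableEq I] [Nonempty I]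
    [Fintype X] [Nonempty X] (g : I → X → ℕ) (c : X → I) :
    ∃ σ : Finset X, ∀ y, ∃ i ∈ σ.image c, ∀ x ∈ σ, g i y ≤ g i x := by
  classical
  set M := Fintype.card X
  let e := Fintype.equivFin X
  let e' := Fintype.equivFin I
  let q : I → X → ℕ := fun i x => g i x * M + e x + 1
  have hq : ∀ i x y, q i x ≤ q i y → g i x ≤ g i y := by
    intro i x y h
    by_contra! hlt
    have h1 : (g i y + 1) * M ≤ g i x * M := Nat.mul_le_mul_right _ hlt
    have h2 := (e y).2
    simp only [q] at h
    lia
  have hqinj : ∀ i, Function.Injective (q i) := by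
    intro i x y h
    have h1 : g i x = g i y := le_antisymm (hq i x y h.le) (hq i y x h.ge)
    simp only [q, h1] at h
    exact e.injective (Fin.ext (by lia))
  let K : I → ℕ := fun i => ∑ x, q i x
  have hK : ∀ i x, q i x ≤ K i := fun i x =>
    Finset.single_le_sum (f := q i) (fun _ _ => Nat.zero_le _) (Finset.mem_univ x)
  let r : I → X ⊕ I → ℕ := fun i z =>
    Sum.elim (q i) (fun j => if j = i then 0 else K i + 1 + e' j) z
  have hrself : ∀ i, r i (Sum.inr i) = 0 := fun i => by simp [r]
  have hrpos : ∀ i x, 0 < r i (Sum.inl x) := fun i x => by simp [r, q]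
  have hrlt : ∀ i j x, j ≠ i → r i (Sum.inl x) < r i (Sum.inr j) := fun i j x h => by
    have := hK i x
    simp only [r, Sum.elim_inl, Sum.elim_inr, if_neg h]
    lia
  have hrinj : ∀ i, Function.Injective (r i) := by
    intro i
    rintro (x | j) (y | l) h
    · exact congrArg _ (hqinj i h)
    · rcases eq_or_ne l i with rfl | hl
      · exact absurd h (by rw [hrself]; exact (hrpos _ _).ne')
      · exact absurd h (hrlt i l x hl).ne
    · rcases eq_or_ne j i with rfl | hl
      · exact absurd h (by rw [hrself]; exact (hrpos _ _).ne)
      · exact absurd h (hrlt i j y hl).ne'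
    · congr 1
      simp only [r, Sum.elim_inr] at h
      split_ifs at h with h1 h2 h2
      · rw [h1, h2]
      · lia
      · lia
      · exact e'.injective (Fin.ext (by lia))
  obtain ⟨k⟩ := ‹Nonempty I›
  set T₀ : Finset (X ⊕ I) := (Finset.univ.erase k).image Sum.inr
  have hcard₀ : T₀.card + 1 = Fintype.card I := by
    rw [Finset.card_image_of_injective _ Sum.inr_injective,
      Finset.card_erase_add_one (Finset.mem_univ k), Finset.card_univ]
  have hmem₀ : ∀ j, Sum.inr j ∈ T₀ ↔ j ≠ k := by simp [T₀]
  obtain ⟨x₀, -, hx₀⟩ := Finset.exists_max_image (Finset.univ : Finset X) (q k)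
    Finset.univ_nonempty
  suffices hmain : ∃ S : Finset (X ⊕ I), S.card = Fintype.card I ∧ IsDominant r S ∧
      S.image (Sum.elim c id) = Finset.univ by
    obtain ⟨S, -, hS, hSc⟩ := hmain
    refine ⟨Finset.univ.filter fun x => Sum.inl x ∈ S, fun y => ?_⟩
    obtain ⟨i, hi⟩ := hS (Sum.inl y)
    have hiS : Sum.inr i ∉ S := fun h => by
      have := hi _ h
      rw [hrself] at this
      exact absurd (hrpos i y) this.not_gt
    refine ⟨i, ?_, fun x hx => hq i y x (hi (Sum.inl x) (by simpa using hx))⟩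
    have : i ∈ S.image (Sum.elim c id) := by rw [hSc]; exact Finset.mem_univ i
    obtain ⟨z | j, hz, hzi⟩ := Finset.mem_image.1 this
    · exact Finset.mem_image.2 ⟨z, by simpa using hz, hzi⟩
    · obtain rfl : j = i := hzi
      exact absurd hz hiS
  refine exists_isDominant_image_eq_univ _ k hcard₀ ?_ ?_ hrinj ?_
  · simp [T₀, Finset.image_image]
  · refine ⟨Sum.inl x₀, ⟨by simp [T₀], ?_⟩, ?_⟩
    · rintro (y | j)
      · refine ⟨k, fun z hz => ?_⟩
        rcases Finset.mem_insert.1 hz with rfl | hz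
        · exact hx₀ y (Finset.mem_univ y)
        · rcases z with z | j
          · simp [T₀] at hz
          · exact (hrlt k j y ((hmem₀ j).1 hz)).le
      · exact ⟨j, fun z _ => by rw [hrself]; exact Nat.zero_le _⟩
    · rintro w ⟨hw, hdom⟩
      obtain ⟨i, hi⟩ := hdom (Sum.inl x₀)
      have hiT : Sum.inr i ∉ insert w T₀ := fun h => by
        have := hi _ h
        rw [hrself] at this
        exact absurd (hrpos i x₀) this.not_gt
      have hik : i = k := by
        by_contra h
        exact hiT (Finset.mem_insert_of_mem ((hmem₀ i).2 h))
      subst hik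
      rcases w with x | j
      · congr 1
        exact hqinj i (le_antisymm (hx₀ x (Finset.mem_univ x)) (hi _ (Finset.mem_insert_self _ _)))
      · have hj : j = i := by simpa [hmem₀] using hw
        subst hj
        exact absurd (Finset.mem_insert_self _ _) hiT
  · intro T hne hcard hc _
    obtain ⟨x, hx⟩ : ∃ x, Sum.inl x ∈ T := by
      by_contra! h
      apply hne
      have hsub : T ⊆ T₀ := by
        rintro (x | j) hz
        · exact absurd hz (h x)
        · rw [hmem₀]
          have : j ∈ T.image (Sum.elim c id) := Finset.mem_image.2 ⟨_, hz, rfl⟩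
          rw [hc] at this
          simpa using this
      apply Finset.eq_of_subset_of_card_le hsub
      lia
    exact ⟨⟨_, hx⟩, fun a => ⟨Sum.inr a, fun i hi => ⟨_, hx, hrlt i a x hi.symm⟩⟩⟩

/-- For any colouring of the lattice points of a dilated simplex, there is a cluster of lattice points
carrying all the colours `i` at which the coordinates of the cluster are not small. -/
theorem exists_cluster {I : Type*} [Fintype I] [DecidableEq I] [Nonempty I] (N : ℕ)
    (c : (I → ℕ) → I) :
    ∃ x₀ : I → ℕ, ∑ i, x₀ i = N ∧ ∀ i, Fintype.card I ≤ x₀ i →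
      ∃ x : I → ℕ, ∑ i, x i = N ∧ c x = i ∧
        ∀ j, x j ≤ x₀ j + Fintype.card I ∧ x₀ j ≤ x j + Fintype.card I := by
  classical
  set n := Fintype.card I
  let X := ↥(Finset.piAntidiag (Finset.univ : Finset I) N)
  have hX : ∀ x : I → ℕ, x ∈ Finset.piAntidiag Finset.univ N ↔ ∑ i, x i = N := by
    simp [Finset.mem_piAntidiag]
  have : Nonempty X :=
    ⟨⟨Pi.single (Classical.arbitrary I) N, (hX _).2 (by simp)⟩⟩
  obtain ⟨σ, hσ⟩ := exists_undominated_finset (fun i (x : X) => x.1 i) (fun x => c x.1)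
  set C := σ.image fun x => c x.1
  obtain ⟨i₁, hi₁, -⟩ := hσ (Classical.arbitrary X)
  obtain ⟨x₀, hx₀, -⟩ := Finset.mem_image.1 hi₁
  choose m hmσ hm using fun i => Finset.exists_min_image σ (fun x : X => x.1 i) ⟨x₀, hx₀⟩
  have hsum : N < ∑ i ∈ C, ((m i).1 i + 1) := by
    by_contra! hle
    let y : I → ℕ := fun i => (if i ∈ C then (m i).1 i + 1 else 0) +
      (Pi.single i₁ (N - ∑ i ∈ C, ((m i).1 i + 1)) : I → ℕ) i
    have hy : ∑ i, y i = N := by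
      simp only [y, Finset.sum_add_distrib, Finset.sum_ite_mem, Finset.univ_inter]
      simp [Finset.sum_add_distrib] at hle ⊢
      lia
    obtain ⟨i, hiC, hi⟩ := hσ ⟨y, (hX y).2 hy⟩
    have := hi (m i) (hmσ i)
    simp only [y, if_pos hiC] at this
    lia
  have hsum' : N < ∑ i ∈ C, (m i).1 i + n := by
    rw [Finset.sum_add_distrib] at hsum
    have : C.card ≤ n := Finset.card_le_univ C
    simp at hsum
    lia
  have hxN : ∀ x : X, ∀ s : Finset I, ∑ i ∈ s, x.1 i ≤ N := fun x s => by
    have := (hX x.1).1 x.2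
    exact (Finset.sum_le_univ_sum_of_nonneg fun _ => Nat.zero_le _).trans this.le
  have hlow : ∀ x ∈ σ, ∀ s : Finset I, ∑ i ∈ s, (m i).1 i ≤ ∑ i ∈ s, x.1 i := fun x hx s =>
    Finset.sum_le_sum fun i _ => hm i x hx
  have hout : ∀ x ∈ σ, ∀ j ∉ C, x.1 j < n := by
    intro x hx j hj
    have h1 := hxN x (insert j C)
    rw [Finset.sum_insert hj] at h1
    have h2 := hlow x hx C
    lia
  have hin : ∀ x ∈ σ, ∀ x' ∈ σ, ∀ j, x.1 j ≤ x'.1 j + n := by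
    intro x hx x' hx' j
    by_cases hj : j ∈ C
    · have h1 := hxN x C
      have h2 := hlow x hx (C.erase j)
      rw [← Finset.add_sum_erase _ _ hj] at h1 hsum'
      have h3 := hm j x' hx'
      lia
    · have := hout x hx j hj
      lia
  refine ⟨x₀.1, (hX _).1 x₀.2, fun i hi => ?_⟩
  have hiC : i ∈ C := by
    by_contra h
    exact absurd (hout x₀ hx₀ i h) hi.not_gt
  obtain ⟨x, hx, hxi⟩ := Finset.mem_image.1 hiC
  exact ⟨x.1, (hX _).1 x.2, hxi, fun j => ⟨hin x hx x₀ hx₀ j, hin x₀ hx₀ x hx j⟩⟩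

/-- A closed cover of the standard simplex indexed by its vertices has a point lying in every
member of the cover whose index is in the support of the point. -/
theorem exists_mem_of_closed_cover_stdSimplex {I : Type*} [Fintype I] [Nonempty I]
    (G : I → Set (I → ℝ)) (hG : ∀ i, IsClosed (G i))
    (hcov : ∀ w ∈ stdSimplex ℝ I, ∃ i, w ∈ G i) :
    ∃ w ∈ stdSimplex ℝ I, ∀ i, 0 < w i → w ∈ G i := by
  classical
  set n := Fintype.card I
  let sc : ℕ → (I → ℕ) → I → ℝ := fun N x i => x i / ((N : ℝ) + 1)
  have hsc : ∀ N (x : I → ℕ), ∑ i, x i = N + 1 → sc N x ∈ stdSimplex ℝ I := by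
    intro N x hx
    refine ⟨fun i => by positivity, ?_⟩
    simp only [sc]
    rw [← Finset.sum_div, ← Nat.cast_sum, hx]
    push_cast
    exact div_self (by positivity)
  have hcol : ∀ w : I → ℝ, ∃ i, w ∈ stdSimplex ℝ I → w ∈ G i := fun w => by
    by_cases hw : w ∈ stdSimplex ℝ I
    · exact (hcov w hw).imp fun i hi _ => hi
    · exact ⟨Classical.arbitrary I, fun h => absurd h hw⟩
  choose c hc using hcol
  choose z hz hcl using fun N : ℕ => exists_cluster (N + 1) fun x => c (sc N x)
  obtain ⟨w, hw, φ, hφ, hlim⟩ := (isCompact_stdSimplex ℝ I).tendsto_subseq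
    fun N => hsc N (z N) (hz N)
  refine ⟨w, hw, fun i hi => ?_⟩
  have hsmall : Filter.Tendsto (fun k => (n : ℝ) / ((φ k : ℝ) + 1)) Filter.atTop (nhds 0) :=
    tendsto_const_nhds.div_atTop <| Filter.tendsto_atTop_add_const_right _ _ <|
      tendsto_natCast_atTop_atTop.comp hφ.tendsto_atTop
  have hev : ∀ᶠ k in Filter.atTop, (n : ℝ) / ((φ k : ℝ) + 1) < sc (φ k) (z (φ k)) i :=
    hsmall.eventually_lt ((tendsto_pi_nhds.1 hlim) i) hi
  have hex : ∀ k, ∃ x : I → ℝ, ((n : ℝ) / ((φ k : ℝ) + 1) < sc (φ k) (z (φ k)) i → x ∈ G i) ∧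
      ∀ j, |x j - sc (φ k) (z (φ k)) j| ≤ (n : ℝ) / ((φ k : ℝ) + 1) := by
    intro k
    by_cases h : (n : ℝ) / ((φ k : ℝ) + 1) < sc (φ k) (z (φ k)) i
    · have hpos : (0 : ℝ) < (φ k : ℝ) + 1 := by positivity
      have hle : n ≤ z (φ k) i := by
        have := (div_lt_div_iff_of_pos_right hpos).1 h
        exact_mod_cast this.le
      obtain ⟨x, hx, hxi, hxz⟩ := hcl (φ k) i hle
      refine ⟨sc (φ k) x, fun _ => hxi ▸ hc _ (hsc _ x hx), fun j => ?_⟩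
      simp only [sc]
      rw [← sub_div, abs_div, abs_of_pos hpos]
      refine div_le_div_of_nonneg_right (abs_sub_le_iff.2 ⟨?_, ?_⟩) hpos.le
      · have := (hxz j).1
        rw [sub_le_iff_le_add']
        exact_mod_cast this
      · have := (hxz j).2
        rw [sub_le_iff_le_add']
        exact_mod_cast this
    · exact ⟨sc (φ k) (z (φ k)), fun h' => absurd h' h, fun j => by simp; positivity⟩
  choose x hxG hx using hex
  have hxlim : Filter.Tendsto x Filter.atTop (nhds w) := by
    rw [tendsto_pi_nhds]
    intro j
    have h1 : Filter.Tendsto (fun k => x k j - sc (φ k) (z (φ k)) j) Filter.atTop (nhds 0) :=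
      squeeze_zero_norm (fun k => hx k j) hsmall
    have h2 := h1.add ((tendsto_pi_nhds.1 hlim) j)
    simpa using h2
  exact (hG i).mem_of_tendsto hxlim (hev.mono hxG)

section PiecewiseLinear

variable {E : Type*} [AddCommGroup E] [Module ℝ E]

/-- The graph of the map which is affine on every simplex of `T` and sends each vertex `v`
to `y v`. -/
def plGraph (T : Geometry.SimplicialComplex ℝ E) (y : E → E) : Set (E × E) :=
  ⋃ τ ∈ T.faces, (fun w : τ → ℝ => (∑ v, w v • (v : E), ∑ v, w v • y v)) '' stdSimplex ℝ τ

theorem mem_plGraph {T : Geometry.SimplicialComplex ℝ E} {y : E → E} {q : E × E} :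
    q ∈ plGraph T y ↔ ∃ τ ∈ T.faces, ∃ w ∈ stdSimplex ℝ τ,
      ∑ v, w v • (v : E) = q.1 ∧ ∑ v, w v • y v = q.2 := by
  simp [plGraph, Prod.ext_iff]

theorem exists_mem_plGraph (T : Geometry.SimplicialComplex ℝ E) (y : E → E) {x : E}
    (hx : x ∈ T.space) : ∃ z, (x, z) ∈ plGraph T y := by
  obtain ⟨τ, hτ, hxτ⟩ := Geometry.SimplicialComplex.mem_space_iff.1 hx
  obtain ⟨w, hw0, hw1, hwx⟩ := Finset.mem_convexHull'.1 hxτ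
  refine ⟨∑ v : τ, w v • y v, mem_plGraph.2 ⟨τ, hτ, fun v => w v, ⟨fun v => hw0 v v.2, ?_⟩, ?_, rfl⟩⟩
  · rw [Finset.sum_coe_sort τ w, hw1]
  · rw [Finset.sum_coe_sort τ fun v => w v • v, hwx]

theorem sum_smul_eq_of_affineIndependent {s t : Finset E}
    (hs : AffineIndependent ℝ ((↑) : s → E)) (hts : t ⊆ s) {w : s → ℝ} {a : E → ℝ}
    (hsum : ∑ v, w v = ∑ v ∈ t, a v) (hx : ∑ v, w v • (v : E) = ∑ v ∈ t, a v • v) (y : E → E) :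
    ∑ v, w v • y v = ∑ v ∈ t, a v • y v := by
  classical
  have hb : ∀ f : E → E,
      ∑ v ∈ t, a v • f v = ∑ v : s, (if (v : E) ∈ t then a v else 0) • f v := by
    intro f
    rw [Finset.sum_coe_sort s fun v => (if v ∈ t then a v else 0) • f v]
    simp only [ite_smul, zero_smul, Finset.sum_ite_mem, Finset.inter_eq_right.2 hts]
  have hzero := hs.eq_zero_of_sum_eq_zero (s := Finset.univ)
    (w := fun v : s => w v - if (v : E) ∈ t then a v else 0) ?_ ?_
  · rw [hb y]
    refine Finset.sum_congr rfl fun v hv => ?_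
    rw [sub_eq_zero.1 (hzero v hv)]
  · rw [Finset.sum_sub_distrib, Finset.sum_coe_sort s fun v => if v ∈ t then a v else 0,
      Finset.sum_ite_mem, Finset.inter_eq_right.2 hts, hsum, sub_self]
  · simp only [sub_smul]
    rw [Finset.sum_sub_distrib, ← hb fun v => v, hx, sub_self]

theorem plGraph_functional {T : Geometry.SimplicialComplex ℝ E} {y : E → E} {x z z' : E}
    (h : (x, z) ∈ plGraph T y) (h' : (x, z') ∈ plGraph T y) : z = z' := by
  classical
  obtain ⟨τ, hτ, w, hw, hwx, hwz⟩ := mem_plGraph.1 h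
  obtain ⟨τ', hτ', w', hw', hwx', hwz'⟩ := mem_plGraph.1 h'
  simp only at hwx hwz hwx' hwz'
  have hmem : ∀ {σ : Finset E} {b : σ → ℝ}, b ∈ stdSimplex ℝ σ →
      ∑ v, b v • (v : E) ∈ convexHull ℝ (σ : Set E) := fun {σ b} hb =>
    (convex_convexHull ℝ _).sum_mem (fun v _ => hb.1 v) hb.2
      fun v _ => subset_convexHull ℝ _ v.2
  have hx : x ∈ convexHull ℝ ((τ ∩ τ' : Finset E) : Set E) := by
    rw [Finset.coe_inter]
    exact T.inter_subset_convexHull hτ hτ' ⟨hwx ▸ hmem hw, hwx' ▸ hmem hw'⟩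
  obtain ⟨a, -, ha1, hax⟩ := Finset.mem_convexHull'.1 hx
  rw [← hwz, ← hwz',
    sum_smul_eq_of_affineIndependent (T.indep hτ) Finset.inter_subset_left
      (hw.2.trans ha1.symm) (hwx.trans hax.symm) y,
    sum_smul_eq_of_affineIndependent (T.indep hτ') Finset.inter_subset_right
      (hw'.2.trans ha1.symm) (hwx'.trans hax.symm) y]

theorem isCompact_plGraph [TopologicalSpace E] [IsTopologicalAddGroup E] [ContinuousSMul ℝ E]
    {T : Geometry.SimplicialComplex ℝ E} (hT : T.faces.Finite) (y : E → E) :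
    IsCompact (plGraph T y) :=
  hT.isCompact_biUnion fun τ _ => (isCompact_stdSimplex ℝ τ).image (by fun_prop)

end PiecewiseLinear

/-- The variational inequality satisfied at some point by a displacement field `p - f x`, where
`f` is a function on the polytope spanned by `S` with compact graph `Γ`. -/
theorem exists_variational_inequality {E : Type*} [NormedAddCommGroup E] [InnerProductSpace ℝ E]
    (S : Finset E) (hS : S.Nonempty) (p : E) {Γ : Set (E × E)} (hΓ : IsCompact Γ)
    (htotal : ∀ x ∈ convexHull ℝ (S : Set E), ∃ z, (x, z) ∈ Γ)
    (hfun : ∀ x z z', (x, z) ∈ Γ → (x, z') ∈ Γ → z = z') :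
    ∃ x ∈ convexHull ℝ (S : Set E), ∃ z, (x, z) ∈ Γ ∧
      ∀ q ∈ convexHull ℝ (S : Set E), inner ℝ (p - z) q ≤ inner ℝ (p - z) x := by
  have : Nonempty S := hS.to_subtype
  let L : (S → ℝ) → E := fun w => ∑ s, w s • (s : E)
  have hLmem : ∀ w ∈ stdSimplex ℝ S, L w ∈ convexHull ℝ (S : Set E) := fun w hw =>
    (convex_convexHull ℝ _).sum_mem (fun v _ => hw.1 v) hw.2
      fun v _ => subset_convexHull ℝ _ v.2
  let G : S → Set (S → ℝ) := fun s => Prod.fst '' ((stdSimplex ℝ S ×ˢ (Prod.snd '' Γ)) ∩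
    {q : (S → ℝ) × E | (L q.1, q.2) ∈ Γ ∧ ∀ t : S, inner ℝ (p - q.2) (t : E) ≤
      inner ℝ (p - q.2) (s : E)})
  have hG : ∀ s, IsClosed (G s) := fun s => by
    refine IsCompact.isClosed (IsCompact.image (IsCompact.inter_right
      ((isCompact_stdSimplex ℝ S).prod (hΓ.image continuous_snd)) ?_) continuous_fst)
    rw [Set.ofPred_and, Set.ofPred_forall]
    refine IsClosed.inter (hΓ.isClosed.preimage
      (f := fun q : (S → ℝ) × E => (L q.1, q.2)) (by fun_prop)) ?_
    exact isClosed_iInter fun t => isClosed_le (by fun_prop) (by fun_prop)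
  obtain ⟨w, hw, hwG⟩ := exists_mem_of_closed_cover_stdSimplex G hG fun w hw => by
    obtain ⟨z, hz⟩ := htotal _ (hLmem w hw)
    obtain ⟨s, -, hs⟩ := Finset.exists_max_image (Finset.univ : Finset S)
      (fun t => inner ℝ (p - z) (t : E)) Finset.univ_nonempty
    exact ⟨s, (w, z), ⟨⟨hw, _, hz, rfl⟩, hz, fun t => hs t (Finset.mem_univ t)⟩, rfl⟩
  obtain ⟨z, hz⟩ := htotal _ (hLmem w hw)
  have hmax : ∀ s : S, 0 < w s → ∀ t : S, inner ℝ (p - z) (t : E) ≤ inner ℝ (p - z) (s : E) := by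
    intro s hs
    obtain ⟨⟨w', z'⟩, ⟨-, hz', hle⟩, rfl⟩ := hwG s hs
    rwa [hfun _ _ _ hz hz']
  refine ⟨L w, hLmem w hw, z, hz, fun q hq => ?_⟩
  have hvert : ∀ t : S, inner ℝ (p - z) (t : E) ≤ inner ℝ (p - z) (L w) := by
    intro t
    calc inner ℝ (p - z) (t : E) = ∑ s, w s * inner ℝ (p - z) (t : E) := by
          rw [← Finset.sum_mul, hw.2, one_mul]
      _ ≤ ∑ s, w s * inner ℝ (p - z) (s : E) := by
          refine Finset.sum_le_sum fun s _ => ?_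
          rcases (hw.1 s).eq_or_lt with h | h
          · rw [← h, zero_mul, zero_mul]
          · exact mul_le_mul_of_nonneg_left (hmax s h t) h.le
      _ = inner ℝ (p - z) (L w) := by
          simp only [L, inner_sum, inner_smul_right]
  have hconv : Convex ℝ {q : E | inner ℝ (p - z) q ≤ inner ℝ (p - z) (L w)} :=
    convex_halfSpace_le (innerSL ℝ (p - z)).isLinear _
  exact convexHull_min (fun t ht => hvert ⟨t, ht⟩) hconv hq

/-- **Sperner–Shapley labeling theorem** (Frick–Zerbib).  Let `P ⊆ ℝ^d` be a
polytope with `p ∈ P`, `T` a triangulation of `P`, and `λ` a Sperner–Shapley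
labeling of `T` (i.e. `λ(v) ∈ F(P)` and `λ(v) ⊆ supp(v)` for every vertex `v` of
`T`).  If a point `y(v) ∈ λ(v)` is assigned to every vertex `v` of `T`, then some
simplex `τ` of `T` satisfies `p ∈ conv{y(v) : v ∈ V(τ)}`. -/
theorem sperner_shapley {d : ℕ} (P : Set (EuclideanSpace ℝ (Fin d)))
    (hP : IsPolytope P) (p : EuclideanSpace ℝ (Fin d)) (hp : p ∈ P)
    (T : Geometry.SimplicialComplex ℝ (EuclideanSpace ℝ (Fin d)))
    (hT : IsTriangulation T P)
    (lam : EuclideanSpace ℝ (Fin d) → Set (EuclideanSpace ℝ (Fin d)))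
    (hlam : ∀ v ∈ T.vertices, lam v ∈ polyFaces P ∧ lam v ⊆ suppFace P v)
    (y : EuclideanSpace ℝ (Fin d) → EuclideanSpace ℝ (Fin d))
    (hy : ∀ v ∈ T.vertices, y v ∈ lam v) :
    ∃ τ ∈ T.faces, p ∈ convexHull ℝ (y '' ↑τ) := by
  obtain ⟨S, rfl⟩ := hP
  obtain ⟨hfin, hspace⟩ := hT
  obtain ⟨x, hx, z, hxz, hmax⟩ := exists_variational_inequality S
    (Finset.coe_nonempty.1 (convexHull_nonempty_iff.1 ⟨p, hp⟩)) p (isCompact_plGraph hfin y)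
    (fun x hx => exists_mem_plGraph T y (hspace ▸ hx)) fun _ _ _ => plGraph_functional
  obtain ⟨τ, hτ, a, ha, hax, haz⟩ := mem_plGraph.1 hxz
  simp only at hax haz
  set u := p - z
  set P := convexHull ℝ (S : Set (EuclideanSpace ℝ (Fin d)))
  have hvert : ∀ v : τ, (v : EuclideanSpace ℝ (Fin d)) ∈ T.vertices := fun v => by
    rw [Geometry.SimplicialComplex.vertices_eq]
    exact Set.mem_biUnion hτ v.2
  have hvP : ∀ v : τ, (v : EuclideanSpace ℝ (Fin d)) ∈ P := fun v =>
    hspace ▸ T.vertices_subset_space (hvert v)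
  let F : Set (EuclideanSpace ℝ (Fin d)) := {q ∈ P | ∀ q' ∈ P, inner ℝ u q' ≤ inner ℝ u q}
  have hF : F ∈ polyFaces P := ⟨⟨x, hx, hmax⟩, Or.inr fun _ => ⟨innerSL ℝ u, rfl⟩⟩
  have hsum : ∑ v, a v * (inner ℝ u x - inner ℝ u (v : EuclideanSpace ℝ (Fin d))) = 0 := by
    have h : inner ℝ u x = ∑ v, a v * inner ℝ u (v : EuclideanSpace ℝ (Fin d)) := by
      rw [← hax]
      simp only [inner_sum, inner_smul_right]
    simp only [mul_sub, Finset.sum_sub_distrib]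
    rw [← Finset.sum_mul, ha.2, one_mul, ← h, sub_self]
  rw [Finset.sum_eq_zero_iff_of_nonneg fun v _ =>
    mul_nonneg (ha.1 v) (sub_nonneg.2 (hmax v (hvP v)))] at hsum
  have hyF : ∀ v : τ, a v ≠ 0 → y v ∈ F := fun v hv => by
    have h0 := (mul_eq_zero.1 (hsum v (Finset.mem_univ v))).resolve_left hv
    have hvF : (v : EuclideanSpace ℝ (Fin d)) ∈ F :=
      ⟨hvP v, fun q hq => (hmax q hq).trans (sub_eq_zero.1 h0).le⟩
    exact (hlam v (hvert v)).2 (hy v (hvert v)) F ⟨hF, hvF⟩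
  have hpz : inner ℝ u p ≤ inner ℝ u z := by
    rw [← haz]
    simp only [inner_sum, inner_smul_right]
    calc inner ℝ u p = ∑ v, a v * inner ℝ u p := by rw [← Finset.sum_mul, ha.2, one_mul]
      _ ≤ _ := by
        refine Finset.sum_le_sum fun v _ => ?_
        by_cases hv : a v = 0
        · rw [hv, zero_mul, zero_mul]
        · exact mul_le_mul_of_nonneg_left ((hyF v hv).2 p hp) (ha.1 v)
  have hu0 : p - z = 0 := by
    rw [← inner_self_eq_zero (𝕜 := ℝ)]
    refine le_antisymm ?_ real_inner_self_nonneg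
    rw [inner_sub_right]
    exact sub_nonpos.2 hpz
  refine ⟨τ, hτ, ?_⟩
  rw [sub_eq_zero.1 hu0, ← haz]
  exact (convex_convexHull ℝ _).sum_mem (fun v _ => ha.1 v) ha.2
    fun v _ => subset_convexHull ℝ _ ⟨v, v.2, rfl⟩
end
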